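/- Assume (cond1), |U| = 1, and that the diffusion is uncontrolled: Σ(x,u) = Σ₀(x) for all u ∈ U, with Σ₀ Lipschitz continuous (so that ε₀ = ε₁ = 0 in (cond2)). Let v* be a bounded C^{2,α} classical solution of the exploratory HJB equation and (v^n) the policy iteration sequence started from v⁰ ∈ C^{2,α}(ℝ^d). Then there exists A₁ ≥ 1 such that if ρ ≥ A₁^{2/(1−α)}, for all n ≥ 1 and x₀ ∈ ℝ^d: ρ∫_{B₁(x₀)}|v^n − v*|² dx + ∫_{B₁(x₀)}|D(v^n − v*)|² dx ≤ C·2^{−n}, ‖D(v^n − v*)‖_∞ ≤ (C·2^{−n})^{1/(d+2)}, and ‖v^n − v*‖_∞ ≤ ρ^{−1/(d+2)}(C·2^{−n})^{1/(d+2)+d/(d+2)²}; i.e., the policy iteration algorithm converges exponentially fast in n. -/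

import Mathlib

open MeasureTheory Real Metric
noncomputable section

/-- First-order partial derivative `∂v/∂xᵢ`. -/
def pd1 (d : ℕ) (v : EuclideanSpace ℝ (Fin d) → ℝ) (x : EuclideanSpace ℝ (Fin d))
    (i : Fin d) : ℝ :=
  fderiv ℝ v x (EuclideanSpace.single i 1)

/-- Second-order partial derivative `∂²v/∂xᵢ∂xⱼ`. -/
def pd2 (d : ℕ) (v : EuclideanSpace ℝ (Fin d) → ℝ) (x : EuclideanSpace ℝ (Fin d))
    (i j : Fin d) : ℝ :=
  fderiv ℝ (fun y => fderiv ℝ v y (EuclideanSpace.single j 1)) x (EuclideanSpace.single i 1)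

/-- The Gibbs density when the diffusion is uncontrolled:
`π(x,u) = exp[(1/λ)(r(x,u)+b(x,u)·Dw(x))] / ∫_U exp[(1/λ)(r(x,u')+b(x,u')·Dw(x))]du'`. -/
def gibbsPolicy1 (d l : ℕ) (lam : ℝ) (U : Set (EuclideanSpace ℝ (Fin l)))
    (r : EuclideanSpace ℝ (Fin d) → EuclideanSpace ℝ (Fin l) → ℝ)
    (b : EuclideanSpace ℝ (Fin d) → EuclideanSpace ℝ (Fin l) → Fin d → ℝ)
    (w : EuclideanSpace ℝ (Fin d) → ℝ)
    (x : EuclideanSpace ℝ (Fin d)) (u : EuclideanSpace ℝ (Fin l)) : ℝ :=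
  Real.exp ((1 / lam) * (r x u + ∑ i, b x u i * pd1 d w x i)) /
    ∫ u' in U, Real.exp ((1 / lam) * (r x u' + ∑ i, b x u' i * pd1 d w x i))

/-- The trace of the product of a matrix with nonnegative quadratic form and a symmetric matrix
bounded above by `k` is at most `k` times the trace of the former. -/
lemma trace_mul_le_of_quadratic_le {d : ℕ} {S A : Fin d → Fin d → ℝ} {k : ℝ}
    (hS : ∀ ξ : Fin d → ℝ, 0 ≤ ∑ i, ∑ j, ξ i * S i j * ξ j)
    (hsymm : ∀ i j, A i j = A j i)
    (hA : ∀ ξ : Fin d → ℝ, ∑ i, ∑ j, ξ i * A i j * ξ j ≤ k * ∑ i, ξ i ^ 2) :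
    ∑ i, ∑ j, S i j * A j i ≤ k * ∑ i, S i i := by
  set N : Matrix (Fin d) (Fin d) ℝ := k • (1 : Matrix (Fin d) (Fin d) ℝ) - Matrix.of A with hN
  have hNij : ∀ i j, N i j = k * (if i = j then 1 else 0) - A i j := by
    intro i j; simp [hN, Matrix.one_apply]
  have hpsd : N.PosSemidef := by
    refine Matrix.PosSemidef.of_dotProduct_mulVec_nonneg ?_ fun ξ => ?_
    · ext i j
      simp only [Matrix.conjTranspose_apply, hNij, star_trivial, hsymm j i, eq_comm]
    · have h := hA ξ
      have : star ξ ⬝ᵥ N.mulVec ξ = k * ∑ i, ξ i ^ 2 - ∑ i, ∑ j, ξ i * A i j * ξ j := by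
        simp only [dotProduct, Matrix.mulVec, hNij, Finset.mul_sum, Pi.star_apply, star_trivial]
        rw [← Finset.sum_sub_distrib]
        refine Finset.sum_congr rfl fun i _ => ?_
        have : k * ξ i ^ 2 = ∑ j, ξ i * (k * (if i = j then 1 else 0)) * ξ j := by
          simp; ring
        rw [this, ← Finset.sum_sub_distrib]
        refine Finset.sum_congr rfl fun j _ => ?_
        ring
      rw [this]; linarith
  obtain ⟨M, hM⟩ : ∃ M : Matrix (Fin d) (Fin d) ℝ, N = M.conjTranspose * M := by
    open scoped MatrixOrder in
    exact CStarAlgebra.nonneg_iff_eq_star_mul_self.mp hpsd.nonneg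
  have hpos : 0 ≤ ∑ i, ∑ j, S i j * N j i := by
    have : ∑ i, ∑ j, S i j * N j i = ∑ l, ∑ i, ∑ j, M l i * S i j * M l j := by
      rw [Finset.sum_comm (s := Finset.univ) (t := Finset.univ) (f := fun l i =>
        ∑ j, M l i * S i j * M l j)]
      refine Finset.sum_congr rfl fun i _ => ?_
      rw [Finset.sum_comm]
      refine Finset.sum_congr rfl fun j _ => ?_
      rw [hM, Matrix.mul_apply, Finset.mul_sum]
      refine Finset.sum_congr rfl fun l _ => ?_
      simp only [Matrix.conjTranspose_apply, star_trivial]; ring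
    rw [this]
    exact Finset.sum_nonneg fun l _ => hS _
  have : ∑ i, ∑ j, S i j * N j i = k * ∑ i, S i i - ∑ i, ∑ j, S i j * A j i := by
    rw [Finset.mul_sum, ← Finset.sum_sub_distrib]
    refine Finset.sum_congr rfl fun i _ => ?_
    have : k * S i i = ∑ j, S i j * (k * (if j = i then 1 else 0)) := by
      simp; ring
    rw [this, ← Finset.sum_sub_distrib]
    refine Finset.sum_congr rfl fun j _ => ?_
    rw [hNij]; ring
  linarith

lemma sum_diag_le_of_abs_le {d : ℕ} {S : Fin d → Fin d → ℝ} {K : ℝ} (h : ∀ i j, |S i j| ≤ K) :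
    ∑ i, S i i ≤ d * K := by
  calc ∑ i, S i i ≤ ∑ _i : Fin d, K := Finset.sum_le_sum fun i _ => (le_abs_self _).trans (h i i)
    _ = d * K := by simp

lemma abs_quadratic_le_of_abs_le {d : ℕ} {S : Fin d → Fin d → ℝ} {K : ℝ}
    (h : ∀ i j, |S i j| ≤ K) (ξ : Fin d → ℝ) :
    |∑ i, ∑ j, ξ i * S i j * ξ j| ≤ d * K * ∑ i, ξ i ^ 2 := by
  rcases Nat.eq_zero_or_pos d with rfl | hd
  · simp
  have hK : 0 ≤ K := (abs_nonneg _).trans (h ⟨0, hd⟩ ⟨0, hd⟩)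
  calc |∑ i, ∑ j, ξ i * S i j * ξ j| ≤ ∑ i, ∑ j, |ξ i| * K * |ξ j| := by
        refine (Finset.abs_sum_le_sum_abs _ _).trans (Finset.sum_le_sum fun i _ => ?_)
        refine (Finset.abs_sum_le_sum_abs _ _).trans (Finset.sum_le_sum fun j _ => ?_)
        rw [abs_mul, abs_mul]
        have := h i j
        gcongr
    _ = K * (∑ i, |ξ i|) ^ 2 := by
        rw [sq, Finset.sum_mul_sum, Finset.mul_sum]
        refine Finset.sum_congr rfl fun i _ => ?_
        rw [Finset.mul_sum]
        refine Finset.sum_congr rfl fun j _ => ?_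
        ring
    _ ≤ K * (d * ∑ i, ξ i ^ 2) := by
        have := sq_sum_le_card_mul_sum_sq (s := (Finset.univ : Finset (Fin d)))
          (f := fun i => |ξ i|)
        simp only [sq_abs, Finset.card_univ, Fintype.card_fin] at this
        gcongr
    _ = d * K * ∑ i, ξ i ^ 2 := by ring

/-- The algebraic core of the Ishii-Lions method: the Hessians at the two points of a doubled
maximum, tested against two nearby uniformly elliptic matrices. -/
lemma trace_sub_trace_le {d : ℕ} {S S' X Y : Fin d → Fin d → ℝ} {C δ ε k m : ℝ} {e : Fin d → ℝ}
    (hC : 1 ≤ C) (hδ : 0 ≤ δ) (hε : 0 ≤ ε) (hk : 0 ≤ k) (hm : 0 ≤ m) (hCδ : C * (d * δ) ≤ 1 / 2)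
    (hS : ∀ ξ : Fin d → ℝ, (1 / C) * ∑ i, ξ i ^ 2 ≤ ∑ i, ∑ j, ξ i * S i j * ξ j)
    (hSb : ∀ i j, |S i j| ≤ C) (hSS : ∀ i j, |S i j - S' i j| ≤ δ)
    (hX : ∀ i j, X i j = X j i) (hY : ∀ i j, Y i j = Y j i)
    (hXY : ∀ ξ : Fin d → ℝ, ∑ i, ∑ j, ξ i * (X i j - Y i j) * ξ j ≤ 2 * ε * ∑ i, ξ i ^ 2)
    (hXk : ∀ ξ : Fin d → ℝ, ∑ i, ∑ j, ξ i * X i j * ξ j ≤ (k + 2 * ε) * ∑ i, ξ i ^ 2)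
    (hYk : ∀ ξ : Fin d → ℝ, ∑ i, ∑ j, ξ i * (-Y i j) * ξ j ≤ k * ∑ i, ξ i ^ 2)
    (he : ∑ i, e i ^ 2 = 1) (hem : ∑ i, ∑ j, e i * (X i j - Y i j) * e j ≤ -m + 2 * ε) :
    (∑ i, ∑ j, S i j * X j i) - (∑ i, ∑ j, S' i j * Y j i) ≤
      -m / (2 * C) + 5 * ε * (d * C) + k * (d * δ * (2 * d * C ^ 2 + 1)) := by
  have hC0 : 0 < C := by linarith
  set η := C * (d * δ) with hη
  have hη0 : 0 ≤ η := by positivity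
  have hdC : (0 : ℝ) ≤ d * C := by positivity
  have htr := sum_diag_le_of_abs_le hSb
  have hquad0 : ∀ ξ : Fin d → ℝ, 0 ≤ ∑ i, ∑ j, ξ i * S i j * ξ j := fun ξ =>
    le_trans (by positivity) (hS ξ)
  have h1 : ∑ i, ∑ j, S i j * (X j i - Y j i) ≤ 4 * ε * (d * C) - m / C := by
    have hq : ∀ ξ : Fin d → ℝ, 0 ≤ ∑ i, ∑ j, ξ i * (S i j - (1 / C) * (e i * e j)) * ξ j := by
      intro ξ
      have hcs := Finset.sum_mul_sq_le_sq_mul_sq Finset.univ ξ e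
      rw [he, mul_one] at hcs
      have : ∑ i, ∑ j, ξ i * (S i j - (1 / C) * (e i * e j)) * ξ j =
          ∑ i, ∑ j, ξ i * S i j * ξ j - (1 / C) * (∑ i, ξ i * e i) ^ 2 := by
        rw [sq, Finset.sum_mul_sum, Finset.mul_sum, ← Finset.sum_sub_distrib]
        refine Finset.sum_congr rfl fun i _ => ?_
        rw [Finset.mul_sum, ← Finset.sum_sub_distrib]
        refine Finset.sum_congr rfl fun j _ => ?_
        ring
      rw [this]
      have h2 := hS ξ
      have h3 : (1 / C) * (∑ i, ξ i * e i) ^ 2 ≤ (1 / C) * ∑ i, ξ i ^ 2 := by gcongr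
      linarith
    have h := trace_mul_le_of_quadratic_le (A := fun i j => X i j - Y i j) hq
      (fun i j => by rw [hX i j, hY i j]) hXY
    have hl : ∑ i, ∑ j, (S i j - (1 / C) * (e i * e j)) * (X j i - Y j i) =
        ∑ i, ∑ j, S i j * (X j i - Y j i) -
          (1 / C) * ∑ i, ∑ j, e i * (X i j - Y i j) * e j := by
      rw [Finset.mul_sum, ← Finset.sum_sub_distrib]
      refine Finset.sum_congr rfl fun i _ => ?_
      rw [Finset.mul_sum, ← Finset.sum_sub_distrib]
      refine Finset.sum_congr rfl fun j _ => ?_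
      rw [hX i j, hY i j]; ring
    have hr : ∑ i, (S i i - (1 / C) * (e i * e i)) = ∑ i, S i i - 1 / C := by
      rw [Finset.sum_sub_distrib, ← Finset.mul_sum]
      simp only [← sq, he, mul_one]
    rw [hl, hr] at h
    have h4 : (1 / C) * ∑ i, ∑ j, e i * (X i j - Y i j) * e j ≤ (1 / C) * (-m + 2 * ε) := by
      gcongr
    have h5 : 2 * ε * (∑ i, S i i - 1 / C) ≤ 2 * ε * (d * C - 1 / C) := by gcongr
    have h6 : (1 / C) * (-m + 2 * ε) = - (m / C) + 2 * ε * (1 / C) := by ring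
    have h7 : 0 ≤ ε * (d * C) := by positivity
    linarith
  have h2 := trace_mul_le_of_quadratic_le hquad0 hX hXk
  have hR : ∀ ξ : Fin d → ℝ, 0 ≤ ∑ i, ∑ j, ξ i * (S' i j - (1 - η) * S i j) * ξ j := by
    intro ξ
    have e1 : ∑ i, ∑ j, ξ i * (S' i j - (1 - η) * S i j) * ξ j =
        η * ∑ i, ∑ j, ξ i * S i j * ξ j - ∑ i, ∑ j, ξ i * (S i j - S' i j) * ξ j := by
      rw [Finset.mul_sum, ← Finset.sum_sub_distrib]
      refine Finset.sum_congr rfl fun i _ => ?_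
      rw [Finset.mul_sum, ← Finset.sum_sub_distrib]
      refine Finset.sum_congr rfl fun j _ => ?_
      ring
    have e2 := (le_abs_self _).trans (abs_quadratic_le_of_abs_le hSS ξ)
    have e3 : η * ((1 / C) * ∑ i, ξ i ^ 2) ≤ η * ∑ i, ∑ j, ξ i * S i j * ξ j := by
      have := hS ξ; gcongr
    have e4 : η * ((1 / C) * ∑ i, ξ i ^ 2) = d * δ * ∑ i, ξ i ^ 2 := by
      rw [hη]; field_simp
    rw [e1]; linarith
  have h3 := trace_mul_le_of_quadratic_le hR (A := fun i j => -Y i j)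
    (fun i j => by rw [hY i j]) hYk
  have htrR : ∑ i, (S' i i - (1 - η) * S i i) ≤ d * δ + η * (d * C) := by
    have e1 : ∑ i, (S' i i - (1 - η) * S i i) = ∑ i, (S' i i - S i i) + η * ∑ i, S i i := by
      rw [Finset.mul_sum, ← Finset.sum_add_distrib]
      exact Finset.sum_congr rfl fun i _ => by ring
    have e2 := sum_diag_le_of_abs_le (S := fun i j => S' i j - S i j) (K := δ)
      (fun i j => by rw [abs_sub_comm]; exact hSS i j)
    rw [e1]
    have : η * ∑ i, S i i ≤ η * (d * C) := by gcongr
    linarith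
  have hdecomp : (∑ i, ∑ j, S i j * X j i) - (∑ i, ∑ j, S' i j * Y j i) =
      (1 - η) * ∑ i, ∑ j, S i j * (X j i - Y j i) + η * ∑ i, ∑ j, S i j * X j i +
      ∑ i, ∑ j, (S' i j - (1 - η) * S i j) * -Y j i := by
    simp only [Finset.mul_sum]
    rw [← Finset.sum_sub_distrib, ← Finset.sum_add_distrib, ← Finset.sum_add_distrib]
    refine Finset.sum_congr rfl fun i _ => ?_
    rw [← Finset.sum_sub_distrib, ← Finset.sum_add_distrib, ← Finset.sum_add_distrib]
    refine Finset.sum_congr rfl fun j _ => ?_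
    ring
  rw [hdecomp]
  have a1 : (1 - η) * ∑ i, ∑ j, S i j * (X j i - Y j i) ≤ 4 * ε * (d * C) - m / (2 * C) := by
    have b1 : (1 - η) * ∑ i, ∑ j, S i j * (X j i - Y j i) ≤
        (1 - η) * (4 * ε * (d * C) - m / C) :=
      mul_le_mul_of_nonneg_left h1 (by linarith)
    have b2 : m / C = 2 * (m / (2 * C)) := by field_simp
    have b3 : 0 ≤ m / (2 * C) := by positivity
    have b4 : 0 ≤ η * (4 * ε * (d * C)) := by positivity
    rw [b2] at b1
    nlinarith
  have a2 : η * ∑ i, ∑ j, S i j * X j i ≤ η * (k * (d * C)) + ε * (d * C) := by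
    have b1 : ∑ i, ∑ j, S i j * X j i ≤ (k + 2 * ε) * (d * C) :=
      h2.trans (mul_le_mul_of_nonneg_left htr (by positivity))
    have b2 : η * ∑ i, ∑ j, S i j * X j i ≤ η * ((k + 2 * ε) * (d * C)) := by gcongr
    have b3 : η * (ε * (d * C)) ≤ 1 / 2 * (ε * (d * C)) := by gcongr
    nlinarith
  have a3 := h3.trans (mul_le_mul_of_nonneg_left htrR hk)
  have a4 : k * (d * δ * (2 * d * C ^ 2 + 1)) =
      η * (k * (d * C)) + k * (d * δ + η * (d * C)) := by rw [hη]; ring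
  have a5 : -m / (2 * C) = -(m / (2 * C)) := by ring
  rw [a4, a5]
  linarith

/-- Second-order necessary condition at a local maximum of a function of a real variable. -/
lemma deriv_deriv_nonpos_of_isLocalMax {ψ : ℝ → ℝ} {t : ℝ} (h : IsLocalMax ψ t)
    (hc : ContinuousAt ψ t) : deriv (deriv ψ) t ≤ 0 := by
  by_contra! hpos
  have hmin := isLocalMin_of_deriv_deriv_pos hpos h.deriv_eq_zero hc
  have hconst : ψ =ᶠ[nhds t] fun _ => ψ t := by
    filter_upwards [h, hmin] with s h1 h2 using le_antisymm h1 h2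
  have : deriv (deriv ψ) t = 0 := by
    rw [hconst.deriv.deriv_eq]; simp
  linarith

section Touching

variable {E : Type*} [NormedAddCommGroup E] [InnerProductSpace ℝ E]

lemma hasDerivAt_comp_line {w : E → ℝ} (hw : ContDiff ℝ 2 w) (x ξ : E) (t : ℝ) :
    HasDerivAt (fun t : ℝ => w (x + t • ξ)) (fderiv ℝ w (x + t • ξ) ξ) t := by
  have h1 : HasDerivAt (fun t : ℝ => x + t • ξ) ξ t := by
    simpa using ((hasDerivAt_id t).smul_const ξ).const_add x
  exact ((hw.differentiable (by norm_num)) _).hasFDerivAt.comp_hasDerivAt t h1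

lemma hasDerivAt_fderiv_comp_line {w : E → ℝ} (hw : ContDiff ℝ 2 w) (x ξ : E) (t : ℝ) :
    HasDerivAt (fun t : ℝ => fderiv ℝ w (x + t • ξ) ξ)
      (fderiv ℝ (fderiv ℝ w) (x + t • ξ) ξ ξ) t := by
  have h1 : HasDerivAt (fun t : ℝ => x + t • ξ) ξ t := by
    simpa using ((hasDerivAt_id t).smul_const ξ).const_add x
  have h2 : Differentiable ℝ (fderiv ℝ w) :=
    (hw.fderiv_right (m := 1) (by norm_num)).differentiable (by norm_num)
  have h3 := (h2 (x + t • ξ)).hasFDerivAt.comp_hasDerivAt t h1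
  simpa using h3.clm_apply (hasDerivAt_const t ξ)

/-- First- and second-order conditions along a line for a doubled function touched from above. -/
lemma doubling_conditions {w : E → ℝ} (hw : ContDiff ℝ 2 w) {x y ξ η : E} {g g' : ℝ → ℝ} {c : ℝ}
    (hg : ∀ᶠ t in nhds (0 : ℝ), HasDerivAt g (g' t) t) (hg' : HasDerivAt g' c 0)
    (hmax : ∀ᶠ t in nhds (0 : ℝ), w (x + t • ξ) - w (y + t • η) - g t ≤ w x - w y - g 0) :
    fderiv ℝ w x ξ - fderiv ℝ w y η = g' 0 ∧
      fderiv ℝ (fderiv ℝ w) x ξ ξ - fderiv ℝ (fderiv ℝ w) y η η ≤ c := by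
  set ψ : ℝ → ℝ := fun t => w (x + t • ξ) - w (y + t • η) - g t with hψ
  set ψ' : ℝ → ℝ := fun t => fderiv ℝ w (x + t • ξ) ξ - fderiv ℝ w (y + t • η) η - g' t with hψ'
  have hloc : IsLocalMax ψ 0 := by
    filter_upwards [hmax] with t ht
    simpa [hψ] using ht
  have hd : ∀ᶠ t in nhds (0 : ℝ), HasDerivAt ψ (ψ' t) t := by
    filter_upwards [hg] with t ht
    exact ((hasDerivAt_comp_line hw x ξ t).sub (hasDerivAt_comp_line hw y η t)).sub ht
  have hd' := ((hasDerivAt_fderiv_comp_line hw x ξ 0).sub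
    (hasDerivAt_fderiv_comp_line hw y η 0)).sub hg'
  have hev : deriv ψ =ᶠ[nhds 0] ψ' := hd.mono fun t ht => ht.deriv
  have h1 : ψ' 0 = 0 := by
    rw [← hd.self_of_nhds.deriv]; exact hloc.deriv_eq_zero
  have h2 := deriv_deriv_nonpos_of_isLocalMax hloc hd.self_of_nhds.continuousAt
  rw [hev.deriv_eq] at h2
  have h3 := hd'.deriv
  change deriv ψ' 0 = _ at h3
  rw [h3] at h2
  simp only [zero_smul, add_zero, hψ'] at h1 h2
  exact ⟨by linarith, by linarith⟩

/-- The conditions of `doubling_conditions` for a quadratic touching function. -/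
lemma doubling_conditions_quadratic {w : E → ℝ} (hw : ContDiff ℝ 2 w) {x y ξ η : E} {b c : ℝ}
    (hmax : ∀ᶠ t in nhds (0 : ℝ),
      w (x + t • ξ) - w (y + t • η) - (w x - w y) ≤ b * t + c * t ^ 2) :
    fderiv ℝ w x ξ - fderiv ℝ w y η = b ∧
      fderiv ℝ (fderiv ℝ w) x ξ ξ - fderiv ℝ (fderiv ℝ w) y η η ≤ 2 * c := by
  have h := doubling_conditions hw (x := x) (y := y) (ξ := ξ) (η := η)
    (g := fun t => b * t + c * t ^ 2) (g' := fun t => b + 2 * c * t) (c := 2 * c)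
    (Filter.Eventually.of_forall fun t => by
      have := ((hasDerivAt_id t).const_mul b).add (((hasDerivAt_id t).pow 2).const_mul c)
      refine this.congr_deriv ?_
      simp; ring)
    (by
      have := (((hasDerivAt_id (0 : ℝ)).const_mul (2 * c)).const_add b)
      simpa using this)
    (by filter_upwards [hmax] with t ht; simp; linarith)
  simpa using h

/-- A concave modulus `r - r ^ (1 + γ)` is touched from above at `s` by a quadratic polynomial. -/
lemma sub_rpow_le_quadratic {γ s r : ℝ} (hγ : 0 < γ) (hs : 0 < s) (hr : 0 ≤ r)
    (hsγ : (1 + γ) * s ^ γ ≤ 1) :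
    r - r ^ (1 + γ) ≤ s - s ^ (1 + γ) + (1 - (1 + γ) * s ^ γ) / (2 * s) * (r ^ 2 - s ^ 2) := by
  have h1 := one_add_mul_self_le_rpow_one_add (s := r / s - 1) (p := 1 + γ)
    (by have : 0 ≤ r / s := by positivity
        linarith) (by linarith)
  rw [add_sub_cancel, Real.div_rpow hr hs.le, le_div_iff₀ (by positivity)] at h1
  have h2 : s ^ (1 + γ) = s * s ^ γ := by rw [Real.rpow_add hs, Real.rpow_one]
  have h3 : (1 + (1 + γ) * (r / s - 1)) * s ^ (1 + γ) =
      s ^ (1 + γ) + (1 + γ) * s ^ γ * (r - s) := by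
    rw [h2]; field_simp
  rw [h3] at h1
  have h4 : r - s ≤ (r ^ 2 - s ^ 2) / (2 * s) := by
    rw [le_div_iff₀ (by positivity)]; nlinarith [sq_nonneg (r - s)]
  have h5 : (1 - (1 + γ) * s ^ γ) * (r - s) ≤
      (1 - (1 + γ) * s ^ γ) * ((r ^ 2 - s ^ 2) / (2 * s)) :=
    mul_le_mul_of_nonneg_left h4 (by linarith)
  have h6 : (1 - (1 + γ) * s ^ γ) / (2 * s) * (r ^ 2 - s ^ 2) =
      (1 - (1 + γ) * s ^ γ) * ((r ^ 2 - s ^ 2) / (2 * s)) := by ring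
  rw [h6]; linarith

lemma norm_add_smul_sq (z ξ : E) (t : ℝ) :
    ‖z + t • ξ‖ ^ 2 = ‖z‖ ^ 2 + 2 * inner ℝ z ξ * t + ‖ξ‖ ^ 2 * t ^ 2 := by
  rw [norm_add_sq_real, inner_smul_right, norm_smul, mul_pow, Real.norm_eq_abs, sq_abs]; ring

/-- Derivative conditions at a local maximum of
`w x - w y - L (|x - y| - |x - y| ^ (1 + γ)) - ε |x|²`. -/
lemma ishii_lions_conditions {w : E → ℝ} (hw : ContDiff ℝ 2 w) {L ε γ s : ℝ} {x y : E}
    (hL : 0 ≤ L) (hγ : 0 < γ) (hs : 0 < s) (hxy : ‖x - y‖ = s) (hsγ : (1 + γ) * s ^ γ ≤ 1)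
    (hmax : ∀ᶠ p : E × E in nhds (x, y),
      w p.1 - w p.2 - L * (‖p.1 - p.2‖ - ‖p.1 - p.2‖ ^ (1 + γ)) - ε * ‖p.1‖ ^ 2 ≤
        w x - w y - L * (s - s ^ (1 + γ)) - ε * ‖x‖ ^ 2) :
    (∀ ξ, fderiv ℝ w x ξ =
      L * (1 - (1 + γ) * s ^ γ) / s * inner ℝ (x - y) ξ + 2 * ε * inner ℝ x ξ) ∧
    (∀ ξ, fderiv ℝ w y ξ = L * (1 - (1 + γ) * s ^ γ) / s * inner ℝ (x - y) ξ) ∧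
    (∀ ξ, fderiv ℝ (fderiv ℝ w) x ξ ξ - fderiv ℝ (fderiv ℝ w) y ξ ξ ≤ 2 * ε * ‖ξ‖ ^ 2) ∧
    (∀ ξ, fderiv ℝ (fderiv ℝ w) x ξ ξ ≤
      (L * (1 - (1 + γ) * s ^ γ) / s + 2 * ε) * ‖ξ‖ ^ 2) ∧
    (∀ ξ, -fderiv ℝ (fderiv ℝ w) y ξ ξ ≤ L * (1 - (1 + γ) * s ^ γ) / s * ‖ξ‖ ^ 2) ∧
    fderiv ℝ (fderiv ℝ w) x (s⁻¹ • (x - y)) (s⁻¹ • (x - y)) -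
      fderiv ℝ (fderiv ℝ w) y (s⁻¹ • (x - y)) (s⁻¹ • (x - y)) ≤
      -(4 * L * (γ * (1 + γ)) * s ^ (γ - 1)) + 2 * ε := by
  have hline : ∀ ξ η : E, ∀ᶠ t in nhds (0 : ℝ),
      w (x + t • ξ) - w (y + t • η) - (w x - w y) ≤
        L * (‖(x - y) + t • (ξ - η)‖ - ‖(x - y) + t • (ξ - η)‖ ^ (1 + γ)
          - (s - s ^ (1 + γ))) + ε * (2 * inner ℝ x ξ * t + ‖ξ‖ ^ 2 * t ^ 2) := by
    intro ξ η
    have hc : Filter.Tendsto (fun t : ℝ => (x + t • ξ, y + t • η)) (nhds 0) (nhds (x, y)) := by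
      have : Continuous (fun t : ℝ => (x + t • ξ, y + t • η)) := by fun_prop
      simpa using this.tendsto 0
    filter_upwards [hc.eventually hmax] with t ht
    have e1 : (x + t • ξ) - (y + t • η) = (x - y) + t • (ξ - η) := by
      rw [smul_sub]; abel
    simp only [e1, norm_add_smul_sq x ξ t] at ht
    linarith
  set Q := L * (1 - (1 + γ) * s ^ γ) / s with hQ
  have hquad : ∀ ξ η : E, ∀ᶠ t in nhds (0 : ℝ),
      w (x + t • ξ) - w (y + t • η) - (w x - w y) ≤
        (Q * inner ℝ (x - y) (ξ - η) + 2 * ε * inner ℝ x ξ) * t +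
          (Q / 2 * ‖ξ - η‖ ^ 2 + ε * ‖ξ‖ ^ 2) * t ^ 2 := by
    intro ξ η
    filter_upwards [hline ξ η] with t ht
    have h1 := sub_rpow_le_quadratic hγ hs (norm_nonneg ((x - y) + t • (ξ - η))) hsγ
    rw [norm_add_smul_sq (x - y) (ξ - η) t, hxy] at h1
    have h2 := mul_le_mul_of_nonneg_left h1 hL
    have h3 : L * ((1 - (1 + γ) * s ^ γ) / (2 * s) *
        (s ^ 2 + 2 * inner ℝ (x - y) (ξ - η) * t + ‖ξ - η‖ ^ 2 * t ^ 2 - s ^ 2)) =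
        Q * inner ℝ (x - y) (ξ - η) * t + Q / 2 * ‖ξ - η‖ ^ 2 * t ^ 2 := by
      rw [hQ]; field_simp; ring
    linarith
  have hx := fun ξ : E => doubling_conditions_quadratic hw (hquad ξ 0)
  have hy := fun ξ : E => doubling_conditions_quadratic hw (hquad 0 ξ)
  have hd := fun ξ : E => doubling_conditions_quadratic hw (hquad ξ ξ)
  simp only [sub_zero, zero_sub, map_zero, inner_zero_right, mul_zero, add_zero, inner_neg_right,
    norm_neg, sub_self, norm_zero, ne_eq, OfNat.ofNat_ne_zero, not_false_eq_true, zero_pow,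
    zero_add] at hx hy hd
  refine ⟨fun ξ => (hx ξ).1, fun ξ => by linarith [(hy ξ).1], fun ξ => by linarith [(hd ξ).2],
    fun ξ => by linarith [(hx ξ).2], fun ξ => by linarith [(hy ξ).2], ?_⟩
  set e := s⁻¹ • (x - y) with he
  have hne : ‖e‖ = 1 := by
    rw [he, norm_smul, hxy, Real.norm_eq_abs, abs_of_pos (inv_pos.mpr hs), inv_mul_cancel₀ hs.ne']
  have hnear : ∀ᶠ t in nhds (0 : ℝ), 0 < s + 2 * t := by
    have : Continuous fun t : ℝ => s + 2 * t := by fun_prop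
    exact this.continuousAt.eventually (lt_mem_nhds (by simpa using hs))
  have hlin : ∀ t : ℝ, HasDerivAt (fun t : ℝ => s + 2 * t) 2 t := fun t => by
    simpa using ((hasDerivAt_id t).const_mul 2).const_add s
  have hfin := doubling_conditions hw (x := x) (y := y) (ξ := e) (η := -e)
    (g := fun t => L * ((s + 2 * t) - (s + 2 * t) ^ (1 + γ)) +
      ε * (2 * inner ℝ x e * t + t ^ 2))
    (g' := fun t => L * (2 - 2 * (1 + γ) * (s + 2 * t) ^ γ) + ε * (2 * inner ℝ x e + 2 * t))
    (c := -(4 * L * (γ * (1 + γ)) * s ^ (γ - 1)) + 2 * ε) ?_ ?_ ?_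
  · simpa using hfin.2
  · filter_upwards [hnear] with t ht
    have h1 := ((hlin t).sub ((hlin t).rpow_const (p := 1 + γ) (Or.inl ht.ne'))).const_mul L
    have h2 := ((((hasDerivAt_id t).const_mul (2 * inner ℝ x e)).add
      ((hasDerivAt_id t).pow 2))).const_mul ε
    refine (h1.add h2).congr_deriv ?_
    rw [show 1 + γ - 1 = γ by ring]
    simp
  · have h0 : s + 2 * (0 : ℝ) ≠ 0 := by simpa using hs.ne'
    have h1 := ((((hlin 0).rpow_const (p := γ) (Or.inl h0)).const_mul
      (2 * (1 + γ))).const_sub 2).const_mul L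
    have h2 := (((hasDerivAt_id (0 : ℝ)).const_mul 2).const_add (2 * inner ℝ x e)).const_mul ε
    refine (h1.add h2).congr_deriv ?_
    simp
    ring
  · filter_upwards [hline e (-e), hnear] with t ht hpos
    have e1 : (x - y) + t • (e - -e) = (s + 2 * t) • e := by
      have : x - y = s • e := by rw [he, smul_smul, mul_inv_cancel₀ hs.ne', one_smul]
      rw [this, sub_neg_eq_add, add_smul, smul_add, ← add_smul t t e, two_mul]
    rw [e1, norm_smul, hne, mul_one, Real.norm_eq_abs, abs_of_pos hpos] at ht
    simp only [one_pow, one_mul, mul_zero, add_zero, ne_eq, OfNat.ofNat_ne_zero,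
      not_false_eq_true, zero_pow] at ht ⊢
    linarith

end Touching

section Elliptic

variable {d : ℕ}

lemma pd2_eq_fderiv_fderiv {w : EuclideanSpace ℝ (Fin d) → ℝ} (hw : ContDiff ℝ 2 w)
    (x : EuclideanSpace ℝ (Fin d)) (i j : Fin d) :
    pd2 d w x i j =
      fderiv ℝ (fderiv ℝ w) x (EuclideanSpace.single i 1) (EuclideanSpace.single j 1) := by
  have h2 : Differentiable ℝ (fderiv ℝ w) :=
    (hw.fderiv_right (m := 1) (by norm_num)).differentiable (by norm_num)
  have h := (h2 x).hasFDerivAt.clm_apply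
    (hasFDerivAt_const (EuclideanSpace.single j (1 : ℝ)) x)
  rw [pd2, h.fderiv]
  simp

lemma pd2_symm {w : EuclideanSpace ℝ (Fin d) → ℝ} (hw : ContDiff ℝ 2 w)
    (x : EuclideanSpace ℝ (Fin d)) (i j : Fin d) : pd2 d w x i j = pd2 d w x j i := by
  rw [pd2_eq_fderiv_fderiv hw, pd2_eq_fderiv_fderiv hw]
  exact (hw.contDiffAt.isSymmSndFDerivAt (by simp)) _ _

lemma toLp_eq_sum_single (ξ : Fin d → ℝ) :
    (WithLp.toLp 2 ξ : EuclideanSpace ℝ (Fin d)) =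
      ∑ i, ξ i • EuclideanSpace.single i (1 : ℝ) := by
  ext j
  simp [Finset.sum_apply, Pi.single_apply]

lemma sum_pd2_eq_fderiv_fderiv {w : EuclideanSpace ℝ (Fin d) → ℝ} (hw : ContDiff ℝ 2 w)
    (x : EuclideanSpace ℝ (Fin d)) (ξ : Fin d → ℝ) :
    ∑ i, ∑ j, ξ i * pd2 d w x i j * ξ j =
      fderiv ℝ (fderiv ℝ w) x (WithLp.toLp 2 ξ) (WithLp.toLp 2 ξ) := by
  simp only [toLp_eq_sum_single ξ, map_sum, map_smul, sum_apply,
    smul_apply, smul_eq_mul, Finset.mul_sum, pd2_eq_fderiv_fderiv hw]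
  rw [Finset.sum_comm]
  refine Finset.sum_congr rfl fun i _ => Finset.sum_congr rfl fun j _ => ?_
  ring

lemma norm_toLp_sq (ξ : Fin d → ℝ) :
    ‖(WithLp.toLp 2 ξ : EuclideanSpace ℝ (Fin d))‖ ^ 2 = ∑ i, ξ i ^ 2 := by
  simp [EuclideanSpace.norm_sq_eq]

lemma abs_inner_single_le (z : EuclideanSpace ℝ (Fin d)) (i : Fin d) :
    |inner ℝ z (EuclideanSpace.single i (1 : ℝ))| ≤ ‖z‖ := by
  simpa using abs_real_inner_le_norm z (EuclideanSpace.single i (1 : ℝ))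

lemma abs_sum_mul_le {β p : Fin d → ℝ} {C P : ℝ} (hβ : ∀ i, |β i| ≤ C) (hp : ∀ i, |p i| ≤ P) :
    |∑ i, β i * p i| ≤ d * (C * P) := by
  calc |∑ i, β i * p i| ≤ ∑ _i : Fin d, C * P := by
        refine (Finset.abs_sum_le_sum_abs _ _).trans (Finset.sum_le_sum fun i _ => ?_)
        rw [abs_mul]
        exact mul_le_mul (hβ i) (hp i) (abs_nonneg _) ((abs_nonneg _).trans (hβ i))
    _ = d * (C * P) := by simp

/-- Maximum principle on the whole space for bounded subsolutions. -/
lemma mul_le_of_subsolution {S : EuclideanSpace ℝ (Fin d) → Fin d → Fin d → ℝ}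
    {β : EuclideanSpace ℝ (Fin d) → Fin d → ℝ} {w : EuclideanSpace ℝ (Fin d) → ℝ}
    {C M G ρ : ℝ} (hC : 0 ≤ C) (hρ : 0 ≤ ρ)
    (hS : ∀ x (ξ : Fin d → ℝ), 0 ≤ ∑ i, ∑ j, ξ i * S x i j * ξ j)
    (hSb : ∀ x i j, |S x i j| ≤ C) (hβ : ∀ x i, |β x i| ≤ C)
    (hw : ContDiff ℝ 2 w) (hM : ∀ x, |w x| ≤ M)
    (heq : ∀ x, ρ * w x - ∑ i, β x i * pd1 d w x i
      - (1 / 2) * ∑ i, ∑ j, S x i j * pd2 d w x j i ≤ G)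
    (x₁ : EuclideanSpace ℝ (Fin d)) : ρ * w x₁ ≤ G := by
  have hM0 : 0 ≤ M := (abs_nonneg _).trans (hM 0)
  set P := Real.sqrt (2 * M + ‖x₁‖ ^ 2) with hP
  have hP0 : 0 ≤ P := Real.sqrt_nonneg _
  set K := ρ * ‖x₁‖ ^ 2 + d * (C * (2 * P)) + d * C with hK
  have hK0 : 0 ≤ K := by positivity
  suffices h : ∀ τ : ℝ, 0 < τ → τ ≤ 1 → ρ * w x₁ ≤ G + τ * K by
    by_contra! hlt
    set τ := min 1 ((ρ * w x₁ - G) / (2 * (K + 1))) with hτ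
    have hτ0 : 0 < τ := lt_min one_pos (div_pos (by linarith) (by linarith))
    have h1 := h τ hτ0 (min_le_left _ _)
    have h2 : τ * (2 * (K + 1)) ≤ ρ * w x₁ - G :=
      (le_div_iff₀ (by linarith)).mp (min_le_right _ _)
    nlinarith
  intro τ hτ0 hτ1
  obtain ⟨x, hx⟩ : ∃ x, ∀ y, w y - τ ^ 2 * ‖y‖ ^ 2 ≤ w x - τ ^ 2 * ‖x‖ ^ 2 := by
    have hcont : Continuous fun y => w y - τ ^ 2 * ‖y‖ ^ 2 := by
      have := hw.continuous
      fun_prop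
    refine hcont.exists_forall_ge' x₁ ?_
    have htend := tendsto_norm_cocompact_atTop (E := EuclideanSpace ℝ (Fin d))
    filter_upwards [htend.eventually_ge_atTop (P / τ + ‖x₁‖)] with y hy
    have h1 : P ≤ τ * ‖y‖ := by
      have : P / τ ≤ ‖y‖ := by linarith [norm_nonneg x₁]
      rw [div_le_iff₀ hτ0] at this; linarith
    have h2 : P ^ 2 ≤ (τ * ‖y‖) ^ 2 := by gcongr
    rw [hP, Real.sq_sqrt (by positivity), mul_pow] at h2
    have h3 := abs_le.mp (hM y)
    have h4 := abs_le.mp (hM x₁)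
    have h5 : τ ^ 2 * ‖x₁‖ ^ 2 ≤ 1 * ‖x₁‖ ^ 2 := by
      gcongr; exact pow_le_one₀ hτ0.le hτ1
    linarith
  have hquad : ∀ ξ, fderiv ℝ w x ξ = 2 * τ ^ 2 * inner ℝ x ξ ∧
      fderiv ℝ (fderiv ℝ w) x ξ ξ ≤ 2 * τ ^ 2 * ‖ξ‖ ^ 2 := by
    intro ξ
    have h := doubling_conditions_quadratic hw (x := x) (y := x) (ξ := ξ) (η := 0)
      (b := 2 * τ ^ 2 * inner ℝ x ξ) (c := τ ^ 2 * ‖ξ‖ ^ 2)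
      (Filter.Eventually.of_forall fun t => by
        have h1 := hx (x + t • ξ)
        rw [norm_add_smul_sq] at h1
        simp only [smul_zero, add_zero]
        linarith)
    refine ⟨by simpa using h.1, ?_⟩
    have := h.2
    simp only [map_zero, sub_zero] at this
    linarith
  have hτx : τ * ‖x‖ ≤ P := by
    refine Real.le_sqrt_of_sq_le ?_
    have h1 := hx x₁
    have h3 := abs_le.mp (hM x)
    have h4 := abs_le.mp (hM x₁)
    have h5 : τ ^ 2 * ‖x₁‖ ^ 2 ≤ 1 * ‖x₁‖ ^ 2 := by
      gcongr; exact pow_le_one₀ hτ0.le hτ1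
    rw [mul_pow]; linarith
  have hdrift : |∑ i, β x i * pd1 d w x i| ≤ d * (C * (2 * (τ * P))) := by
    refine abs_sum_mul_le (hβ x) fun i => ?_
    rw [pd1, (hquad _).1, abs_mul, abs_of_nonneg (by positivity)]
    calc 2 * τ ^ 2 * |inner ℝ x (EuclideanSpace.single i (1 : ℝ))| ≤ 2 * τ ^ 2 * ‖x‖ := by
          gcongr; exact abs_inner_single_le x i
      _ = 2 * (τ * (τ * ‖x‖)) := by ring
      _ ≤ 2 * (τ * P) := by gcongr
  have htr := trace_mul_le_of_quadratic_le (A := fun i j => pd2 d w x i j) (k := 2 * τ ^ 2)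
    (hS x) (pd2_symm hw x) (fun ξ => by
      rw [sum_pd2_eq_fderiv_fderiv hw, ← norm_toLp_sq]; exact (hquad _).2)
  have htr2 : 2 * τ ^ 2 * ∑ i, S x i i ≤ 2 * τ ^ 2 * (d * C) :=
    mul_le_mul_of_nonneg_left (sum_diag_le_of_abs_le (hSb x)) (by positivity)
  have hττ : τ ^ 2 ≤ τ := by nlinarith
  have h1 : ρ * w x ≤ G + d * (C * (2 * (τ * P))) + τ ^ 2 * (d * C) := by
    have := heq x
    have := le_abs_self (∑ i, β x i * pd1 d w x i)
    linarith
  have h2 : ρ * (w x₁ - τ ^ 2 * ‖x₁‖ ^ 2) ≤ ρ * w x := by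
    gcongr
    have := hx x₁
    have : 0 ≤ τ ^ 2 * ‖x‖ ^ 2 := by positivity
    linarith
  have h3 : τ ^ 2 * (d * C) ≤ τ * (d * C) := by gcongr
  have h4 : τ ^ 2 * (ρ * ‖x₁‖ ^ 2) ≤ τ * (ρ * ‖x₁‖ ^ 2) := by gcongr
  rw [hK]; linarith

lemma pd1_neg (w : EuclideanSpace ℝ (Fin d) → ℝ) (x : EuclideanSpace ℝ (Fin d)) (i : Fin d) :
    pd1 d (-w) x i = -pd1 d w x i := by
  simp [pd1, fderiv_neg]

lemma pd2_neg {w : EuclideanSpace ℝ (Fin d) → ℝ} (hw : ContDiff ℝ 2 w)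
    (x : EuclideanSpace ℝ (Fin d)) (i j : Fin d) :
    pd2 d (-w) x i j = -pd2 d w x i j := by
  have h : fderiv ℝ (-w) = -fderiv ℝ w := by ext1 y; simp [fderiv_neg]
  have hn : ContDiff ℝ 2 (-w) := hw.neg
  rw [pd2_eq_fderiv_fderiv hn, pd2_eq_fderiv_fderiv hw, h, fderiv_neg]
  simp

/-- Sup-norm bound for bounded solutions of `ρ w - β · Dw - ½ tr (S D²w) = f`, `|f| ≤ G`. -/
lemma mul_abs_le_of_solution {S : EuclideanSpace ℝ (Fin d) → Fin d → Fin d → ℝ}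
    {β : EuclideanSpace ℝ (Fin d) → Fin d → ℝ} {w : EuclideanSpace ℝ (Fin d) → ℝ}
    {C M G ρ : ℝ} (hC : 0 ≤ C) (hρ : 0 ≤ ρ)
    (hS : ∀ x (ξ : Fin d → ℝ), 0 ≤ ∑ i, ∑ j, ξ i * S x i j * ξ j)
    (hSb : ∀ x i j, |S x i j| ≤ C) (hβ : ∀ x i, |β x i| ≤ C)
    (hw : ContDiff ℝ 2 w) (hM : ∀ x, |w x| ≤ M)
    (heq : ∀ x, |ρ * w x - ∑ i, β x i * pd1 d w x i
      - (1 / 2) * ∑ i, ∑ j, S x i j * pd2 d w x j i| ≤ G)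
    (x : EuclideanSpace ℝ (Fin d)) : ρ * |w x| ≤ G := by
  have h1 := mul_le_of_subsolution hC hρ hS hSb hβ hw hM
    (fun y => (le_abs_self _).trans (heq y)) x
  have h2 := mul_le_of_subsolution (w := -w) hC hρ hS hSb hβ hw.neg (M := M)
    (fun y => by simpa using hM y) (G := G) (fun y => by
      simp only [pd1_neg, pd2_neg hw, Pi.neg_apply, mul_neg, Finset.sum_neg_distrib]
      have := neg_abs_le (ρ * w y - ∑ i, β y i * pd1 d w y i
        - (1 / 2) * ∑ i, ∑ j, S y i j * pd2 d w y j i)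
      linarith [heq y]) x
  rcases abs_cases (w x) with ⟨h, _⟩ | ⟨h, _⟩ <;> rw [h]
  · exact h1
  · exact h2

end Elliptic

section Gradient

variable {d : ℕ}

/-- Existence of a positive interior maximum of the doubled and penalized functional. -/
lemma exists_doubled_isLocalMax {w : EuclideanSpace ℝ (Fin d) → ℝ} (hw : Continuous w)
    {φ : ℝ → ℝ} (hφc : ContinuousOn φ (Set.Ici 0)) {ε M s₀ : ℝ} (hε : 0 < ε)
    (hM : ∀ x, |w x| ≤ M) (hφ : ∀ s, 0 ≤ s → s ≤ s₀ → 0 ≤ φ s)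
    (hφM : 2 * M ≤ φ s₀) {x' y' : EuclideanSpace ℝ (Fin d)} (hxy' : ‖x' - y'‖ ≤ s₀)
    (hpos : 0 < w x' - w y' - φ ‖x' - y'‖ - ε * ‖x'‖ ^ 2) :
    ∃ x y, 0 < ‖x - y‖ ∧ ‖x - y‖ < s₀ ∧ ε * ‖x‖ ^ 2 ≤ 2 * M ∧ 0 < w x - w y ∧
      ∀ᶠ p : EuclideanSpace ℝ (Fin d) × EuclideanSpace ℝ (Fin d) in nhds (x, y),
        w p.1 - w p.2 - φ ‖p.1 - p.2‖ - ε * ‖p.1‖ ^ 2 ≤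
          w x - w y - φ ‖x - y‖ - ε * ‖x‖ ^ 2 := by
  set Φ : EuclideanSpace ℝ (Fin d) × EuclideanSpace ℝ (Fin d) → ℝ := fun p =>
    w p.1 - w p.2 - φ ‖p.1 - p.2‖ - ε * ‖p.1‖ ^ 2 with hΦ
  have hM0 : 0 ≤ M := (abs_nonneg _).trans (hM 0)
  set R := Real.sqrt (2 * M / ε) + 1 with hR
  have hsmall : ∀ p : EuclideanSpace ℝ (Fin d) × EuclideanSpace ℝ (Fin d),
      ‖p.1 - p.2‖ ≤ s₀ → 0 < Φ p → ε * ‖p.1‖ ^ 2 < 2 * M := by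
    intro p hp hpp
    have h1 := abs_le.mp (hM p.1)
    have h2 := abs_le.mp (hM p.2)
    have h3 := hφ _ (norm_nonneg _) hp
    simp only [hΦ] at hpp
    linarith
  have hsmallR : ∀ p : EuclideanSpace ℝ (Fin d) × EuclideanSpace ℝ (Fin d),
      ‖p.1 - p.2‖ ≤ s₀ → 0 < Φ p → ‖p.1‖ < R := by
    intro p hp hpp
    have h1 := hsmall p hp hpp
    have : ‖p.1‖ ≤ Real.sqrt (2 * M / ε) := by
      refine Real.le_sqrt_of_sq_le ?_
      rw [le_div_iff₀ hε]; linarith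
    linarith
  set K : Set (EuclideanSpace ℝ (Fin d) × EuclideanSpace ℝ (Fin d)) :=
    (closedBall 0 R ×ˢ closedBall 0 (R + s₀)) ∩ {p | ‖p.1 - p.2‖ ≤ s₀} with hK
  have hKmem : ∀ p : EuclideanSpace ℝ (Fin d) × EuclideanSpace ℝ (Fin d),
      p ∈ K ↔ ‖p.1‖ ≤ R ∧ ‖p.1 - p.2‖ ≤ s₀ := by
    intro p
    simp only [hK, Set.mem_inter_iff, Set.mem_prod, mem_closedBall_zero_iff, Set.mem_ofPred_eq]
    refine ⟨fun h => ⟨h.1.1, h.2⟩, fun h => ⟨⟨h.1, ?_⟩, h.2⟩⟩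
    have := norm_sub_norm_le p.2 p.1
    rw [norm_sub_rev] at this
    linarith [h.1, h.2]
  have hKc : IsCompact K := by
    refine ((isCompact_closedBall _ _).prod (isCompact_closedBall _ _)).inter_right ?_
    exact isClosed_le (by fun_prop) continuous_const
  have hΦc : Continuous Φ := by
    have h1 : Continuous fun p : EuclideanSpace ℝ (Fin d) × EuclideanSpace ℝ (Fin d) =>
        φ ‖p.1 - p.2‖ :=
      hφc.comp_continuous (by fun_prop) fun p => norm_nonneg _
    have h2 := hw.comp (continuous_fst (X := EuclideanSpace ℝ (Fin d))
      (Y := EuclideanSpace ℝ (Fin d)))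
    have h3 := hw.comp (continuous_snd (X := EuclideanSpace ℝ (Fin d))
      (Y := EuclideanSpace ℝ (Fin d)))
    exact ((h2.sub h3).sub h1).sub (by fun_prop)
  have hmem' : (x', y') ∈ K :=
    (hKmem _).mpr ⟨(hsmallR (x', y') hxy' hpos).le, hxy'⟩
  obtain ⟨⟨x, y⟩, hxyK, hmax⟩ := hKc.exists_isMaxOn ⟨_, hmem'⟩ hΦc.continuousOn
  have hxy : ‖x - y‖ ≤ s₀ := ((hKmem _).mp hxyK).2
  have hΦpos : 0 < Φ (x, y) := lt_of_lt_of_le hpos (hmax hmem')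
  have hΦpos' : 0 < w x - w y - φ ‖x - y‖ - ε * ‖x‖ ^ 2 := hΦpos
  have hpen : 0 ≤ ε * ‖x‖ ^ 2 := by positivity
  have hφxy := hφ _ (norm_nonneg (x - y)) hxy
  have hs0 : 0 < ‖x - y‖ := by
    rw [norm_pos_iff, sub_ne_zero]
    rintro rfl
    linarith
  have hlt : ‖x - y‖ < s₀ := by
    refine lt_of_le_of_ne hxy fun h => ?_
    rw [h] at hΦpos'
    have h1 := abs_le.mp (hM x)
    have h2 := abs_le.mp (hM y)
    linarith
  refine ⟨x, y, hs0, hlt, (hsmall (x, y) hxy hΦpos).le, by linarith, ?_⟩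
  have hopen : IsOpen {p : EuclideanSpace ℝ (Fin d) × EuclideanSpace ℝ (Fin d) |
      ‖p.1‖ < R ∧ ‖p.1 - p.2‖ < s₀} :=
    (isOpen_lt continuous_fst.norm continuous_const).and
      (isOpen_lt (continuous_fst.sub continuous_snd).norm continuous_const)
  filter_upwards [hopen.mem_nhds ⟨hsmallR (x, y) hxy hΦpos, hlt⟩] with p hp
  exact hmax ((hKmem p).mpr ⟨hp.1.le, hp.2.le⟩)

set_option maxHeartbeats 1000000 in
/-- Ishii-Lions estimate: a bounded solution is Lipschitz at scale `s₀`, with the constant `L`,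
as soon as `s₀` is small and `L` is large compared with the data. -/
lemma sub_le_mul_norm_sub_of_solution
    {S : EuclideanSpace ℝ (Fin d) → Fin d → Fin d → ℝ}
    {β : EuclideanSpace ℝ (Fin d) → Fin d → ℝ} {w : EuclideanSpace ℝ (Fin d) → ℝ}
    {C M G ρ γ s₀ L : ℝ} (hC : 1 ≤ C) (hρ : 0 < ρ) (hγ : 0 < γ) (hγ1 : 2 * γ < 1) (hL : 0 ≤ L)
    (hs₀ : 0 < s₀) (hs₀1 : s₀ ≤ 1) (hs₀γ : s₀ ^ γ ≤ 1 / 4)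
    (hs₀C : C * (d * C) * s₀ ^ γ ≤ 1 / 2)
    (hs₀c : (d * C * (2 * d * C ^ 2 + 1) / 2 + 2 * d * C) * s₀ ^ γ ≤ γ * (1 + γ) / C / 2)
    (hLG : 2 * G < L * (γ * (1 + γ) / C / 2) * s₀ ^ (γ - 1)) (hLM : 4 * M ≤ L * s₀)
    (hS : ∀ x (ξ : Fin d → ℝ), (1 / C) * ∑ i, ξ i ^ 2 ≤ ∑ i, ∑ j, ξ i * S x i j * ξ j)
    (hSb : ∀ x i j, |S x i j| ≤ C)
    (hSh : ∀ x y, dist x y ≤ 1 → ∀ i j, |S x i j - S y i j| ≤ C * dist x y ^ (2 * γ))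
    (hβ : ∀ x i, |β x i| ≤ C)
    (hw : ContDiff ℝ 2 w) (hM : ∀ x, |w x| ≤ M)
    (heq : ∀ x, |ρ * w x - ∑ i, β x i * pd1 d w x i
      - (1 / 2) * ∑ i, ∑ j, S x i j * pd2 d w x j i| ≤ G)
    (x' y' : EuclideanSpace ℝ (Fin d)) (hxy' : ‖x' - y'‖ ≤ s₀) :
    w x' - w y' ≤ L * ‖x' - y'‖ := by
  have hC0 : 0 < C := by linarith
  have hM0 : 0 ≤ M := (abs_nonneg _).trans (hM 0)
  have hpow : ∀ s : ℝ, 0 ≤ s → s ≤ s₀ → s ^ (1 + γ) ≤ s / 4 := by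
    intro s hs hss
    rw [Real.rpow_add_of_nonneg hs zero_le_one hγ.le, Real.rpow_one]
    have : s ^ γ ≤ s₀ ^ γ := by gcongr
    nlinarith
  have hL2 : 2 * M ≤ L * (s₀ - s₀ ^ (1 + γ)) := by
    have h1 := hpow s₀ hs₀.le le_rfl
    have h2 : L * (s₀ / 2) ≤ L * (s₀ - s₀ ^ (1 + γ)) := by gcongr; linarith
    linarith
  by_contra! hcon
  set gap := w x' - w y' - L * (‖x' - y'‖ - ‖x' - y'‖ ^ (1 + γ)) with hgap
  have hgap0 : 0 < gap := by
    have : 0 ≤ L * ‖x' - y'‖ ^ (1 + γ) := by positivity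
    rw [hgap, mul_sub]; linarith
  set gap2 := L * (γ * (1 + γ) / C / 2) * s₀ ^ (γ - 1) - 2 * G with hgap2
  have hgap20 : 0 < gap2 := by linarith
  set P := Real.sqrt (2 * M) with hP
  have hP0 : 0 ≤ P := Real.sqrt_nonneg _
  set K := 5 / 2 * (d * C) + 2 * (d * C) * P with hK
  have hK0 : 0 ≤ K := by positivity
  obtain ⟨τ, hτ0, hτ1, hτx, hτK⟩ :
      ∃ τ : ℝ, 0 < τ ∧ τ ≤ 1 ∧ τ * ‖x'‖ ^ 2 < gap ∧ τ * K < gap2 := by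
    refine ⟨min 1 (min (gap / (‖x'‖ ^ 2 + 1)) (gap2 / (K + 1))),
      lt_min one_pos (lt_min (by positivity) (by positivity)), min_le_left _ _, ?_, ?_⟩
    · refine lt_of_le_of_lt (mul_le_mul_of_nonneg_right
        ((min_le_right _ _).trans (min_le_left _ _)) (by positivity)) ?_
      rw [div_mul_eq_mul_div, div_lt_iff₀ (by positivity)]
      nlinarith
    · refine lt_of_le_of_lt (mul_le_mul_of_nonneg_right
        ((min_le_right _ _).trans (min_le_right _ _)) hK0) ?_
      rw [div_mul_eq_mul_div, div_lt_iff₀ (by positivity)]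
      nlinarith
  have hττ : τ ^ 2 ≤ τ := by nlinarith
  obtain ⟨x, y, hs, hss, hpen, hwpos, hmax⟩ := exists_doubled_isLocalMax hw.continuous
    (φ := fun s => L * (s - s ^ (1 + γ)))
    (by
      have : Continuous fun s : ℝ => s ^ (1 + γ) := Real.continuous_rpow_const (by linarith)
      fun_prop)
    (ε := τ ^ 2) (by positivity) hM
    (fun s h0 h1 => mul_nonneg hL (by have := hpow s h0 h1; linarith)) hL2 hxy'
    (by
      have : τ ^ 2 * ‖x'‖ ^ 2 ≤ τ * ‖x'‖ ^ 2 := by gcongr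
      linarith)
  set s := ‖x - y‖ with hsdef
  have hs1 : s ≤ 1 := hss.le.trans hs₀1
  have hsγ : s ^ γ ≤ s₀ ^ γ := by gcongr
  have hsγ0 : 0 < s ^ γ := by positivity
  have hhalf : (1 + γ) * s ^ γ ≤ 2 * (1 / 4) :=
    mul_le_mul (by linarith) (hsγ.trans hs₀γ) hsγ0.le zero_le_two
  have hprod : 0 ≤ (1 + γ) * s ^ γ := by positivity
  obtain ⟨hDx, hDy, hXY, hXk, hYk, he⟩ := ishii_lions_conditions hw hL hγ hs rfl
    (by linarith : (1 + γ) * s ^ γ ≤ 1) hmax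
  set Q := L * (1 - (1 + γ) * s ^ γ) / s with hQ
  have hq0 : 0 ≤ 1 - (1 + γ) * s ^ γ := by linarith
  have hq1 : 1 - (1 + γ) * s ^ γ ≤ 1 := by linarith
  have hQ0 : 0 ≤ Q := by positivity
  have hQs : Q * s ≤ L := by
    rw [hQ, div_mul_cancel₀ _ hs.ne']; exact mul_le_of_le_one_right hL hq1
  have hτxP : τ * ‖x‖ ≤ P := by
    refine Real.le_sqrt_of_sq_le ?_
    rw [mul_pow]; exact hpen
  have hgrad0 : ∀ i, |Q * inner ℝ (x - y) (EuclideanSpace.single i (1 : ℝ))| ≤ L := by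
    intro i
    rw [abs_mul, abs_of_nonneg hQ0]
    exact le_trans (mul_le_mul_of_nonneg_left (abs_inner_single_le _ i) hQ0) hQs
  have hgx : |∑ i, β x i * pd1 d w x i| ≤ d * (C * (L + 2 * (τ * P))) := by
    refine abs_sum_mul_le (hβ x) fun i => ?_
    rw [pd1, hDx]
    refine (abs_add_le _ _).trans (add_le_add (hgrad0 i) ?_)
    rw [abs_mul, abs_of_nonneg (by positivity)]
    calc 2 * τ ^ 2 * |inner ℝ x (EuclideanSpace.single i (1 : ℝ))| ≤ 2 * τ ^ 2 * ‖x‖ := by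
          gcongr; exact abs_inner_single_le x i
      _ = 2 * (τ * (τ * ‖x‖)) := by ring
      _ ≤ 2 * (τ * P) := by gcongr
  have hgy : |∑ i, β y i * pd1 d w y i| ≤ d * (C * L) := by
    refine abs_sum_mul_le (hβ y) fun i => ?_
    rw [pd1, hDy]
    exact hgrad0 i
  have hs2γ : s ^ (2 * γ) = s ^ γ * s ^ γ := by rw [two_mul, Real.rpow_add hs]
  have hfactor : s ^ γ * s ^ (γ - 1) * s = s ^ (2 * γ) := by
    rw [← Real.rpow_add hs, ← Real.rpow_add_one hs.ne']; congr 1; ring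
  have htrace := trace_sub_trace_le (S := S x) (S' := S y) (X := fun i j => pd2 d w x i j)
    (Y := fun i j => pd2 d w y i j) (C := C) (δ := C * s ^ (2 * γ)) (ε := τ ^ 2) (k := Q)
    (m := 4 * L * (γ * (1 + γ)) * s ^ (γ - 1)) (e := fun i => (s⁻¹ • (x - y)) i)
    hC (by positivity) (by positivity) hQ0 (by positivity)
    (by
      have : C * (d * C) * (s ^ γ * s ^ γ) ≤ C * (d * C) * (s₀ ^ γ * 1) := by
        gcongr; linarith
      rw [hs2γ]; linarith)
    (hS x) (hSb x) (fun i j => by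
      have := hSh x y (by rw [dist_eq_norm]; exact hs1) i j
      rwa [dist_eq_norm] at this)
    (pd2_symm hw x) (pd2_symm hw y)
    (fun ξ => by
      simp only [mul_sub, sub_mul, Finset.sum_sub_distrib]
      rw [sum_pd2_eq_fderiv_fderiv hw, sum_pd2_eq_fderiv_fderiv hw, ← norm_toLp_sq]
      exact hXY _)
    (fun ξ => by
      rw [sum_pd2_eq_fderiv_fderiv hw, ← norm_toLp_sq]
      exact hXk _)
    (fun ξ => by
      simp only [mul_neg, neg_mul, Finset.sum_neg_distrib]
      rw [sum_pd2_eq_fderiv_fderiv hw, ← norm_toLp_sq]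
      exact hYk _)
    (by
      rw [← EuclideanSpace.real_norm_sq_eq, norm_smul, ← hsdef, Real.norm_eq_abs,
        abs_of_pos (inv_pos.mpr hs), inv_mul_cancel₀ hs.ne', one_pow])
    (by
      simp only [mul_sub, sub_mul, Finset.sum_sub_distrib]
      rw [sum_pd2_eq_fderiv_fderiv hw, sum_pd2_eq_fderiv_fderiv hw]
      exact he)
  set N := s ^ (γ - 1) with hN
  have hN0 : 0 < N := by positivity
  have hQδ : Q * (d * (C * s ^ (2 * γ)) * (2 * d * C ^ 2 + 1)) ≤
      L * (d * C * (2 * d * C ^ 2 + 1)) * (s ^ γ * N) := by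
    rw [← hfactor]
    calc Q * (d * (C * (s ^ γ * N * s)) * (2 * d * C ^ 2 + 1))
        = Q * s * ((d * C * (2 * d * C ^ 2 + 1)) * (s ^ γ * N)) := by ring
      _ ≤ L * ((d * C * (2 * d * C ^ 2 + 1)) * (s ^ γ * N)) := by gcongr
      _ = _ := by ring
  have hone : 1 ≤ s ^ γ * N := by
    rw [hN, ← Real.rpow_add hs]
    exact Real.one_le_rpow_of_pos_of_le_one_of_nonpos hs hs1 (by linarith)
  have hNs₀ : s₀ ^ (γ - 1) ≤ N :=
    Real.rpow_le_rpow_of_nonpos hs hss.le (by linarith)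
  have hx := (abs_le.mp (heq x)).2
  have hy := (abs_le.mp (heq y)).1
  have hgx' := (abs_le.mp hgx).2
  have hgy' := (abs_le.mp hgy).1
  have hρw : 0 < ρ * (w x - w y) := mul_pos hρ hwpos
  have hmC : -(4 * L * (γ * (1 + γ)) * N) / (2 * C) = -(2 * (L * (γ * (1 + γ) / C) * N)) := by
    field_simp; ring
  rw [hmC] at htrace
  have hdrift : d * C * L * 2 ≤ L * (2 * d * C) * (s ^ γ * N) := by
    have : L * (2 * d * C) * 1 ≤ L * (2 * d * C) * (s ^ γ * N) := by gcongr
    linarith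
  have habsorb : L * N * ((d * C * (2 * d * C ^ 2 + 1) / 2 + 2 * d * C) * s ^ γ) ≤
      L * N * (γ * (1 + γ) / C / 2) := by
    refine mul_le_mul_of_nonneg_left (le_trans ?_ hs₀c) (by positivity)
    gcongr
  have hlow : L * (γ * (1 + γ) / C / 2) * s₀ ^ (γ - 1) ≤ L * (γ * (1 + γ) / C / 2) * N := by
    gcongr
  have hε : τ ^ 2 * (d * C) ≤ τ * (d * C) := by gcongr
  rw [hgap2, hK] at hτK
  linarith

/-- For large discount rates, bounded solutions of `ρ w - β · Dw - ½ tr (S D²w) = f` have gradient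
at most `θ ‖f‖_∞`, uniformly over coefficients with prescribed ellipticity and Hölder bounds. -/
theorem exists_discount_gradient_le (d : ℕ) {α C θ : ℝ} (hα : 0 < α) (hα1 : α < 1) (hC : 1 ≤ C)
    (hθ : 0 < θ) :
    ∃ ρ₀ : ℝ, 1 ≤ ρ₀ ∧ ∀ (ρ G M : ℝ) (S : EuclideanSpace ℝ (Fin d) → Fin d → Fin d → ℝ)
      (β : EuclideanSpace ℝ (Fin d) → Fin d → ℝ) (w : EuclideanSpace ℝ (Fin d) → ℝ),
      ρ₀ ≤ ρ → 0 < G →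
      (∀ x (ξ : Fin d → ℝ), (1 / C) * ∑ i, ξ i ^ 2 ≤ ∑ i, ∑ j, ξ i * S x i j * ξ j) →
      (∀ x i j, |S x i j| ≤ C) →
      (∀ x y, dist x y ≤ 1 → ∀ i j, |S x i j - S y i j| ≤ C * dist x y ^ α) →
      (∀ x i, |β x i| ≤ C) → ContDiff ℝ 2 w → (∀ x, |w x| ≤ M) →
      (∀ x, |ρ * w x - ∑ i, β x i * pd1 d w x i
        - (1 / 2) * ∑ i, ∑ j, S x i j * pd2 d w x j i| ≤ G) →
      (∀ x, ρ * |w x| ≤ G) ∧ ∀ x, ‖fderiv ℝ w x‖ ≤ θ * G := by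
  have hC0 : 0 < C := by linarith
  set γ := α / 2 with hγdef
  have hγ : 0 < γ := by positivity
  have hγα : 2 * γ = α := by rw [hγdef]; ring
  set c₁ := γ * (1 + γ) / C / 2 with hc₁
  have hc₁0 : 0 < c₁ := by positivity
  have hev : ∀ p : ℝ, 0 < p → ∀ K η : ℝ, 0 < η →
      ∀ᶠ s in nhdsWithin (0 : ℝ) (Set.Ioi 0), K * s ^ p < η := by
    intro p hp K η hη
    have hc : Continuous fun s : ℝ => K * s ^ p :=
      continuous_const.mul (Real.continuous_rpow_const hp.le)
    refine nhdsWithin_le_nhds (hc.continuousAt.eventually (gt_mem_nhds ?_))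
    simpa [Real.zero_rpow hp.ne'] using hη
  obtain ⟨s₀, h1, h2, h3, h4, h5, h6⟩ := ((hev γ hγ 1 (1 / 4) (by norm_num)).and
    ((hev γ hγ (C * (d * C)) (1 / 2) (by norm_num)).and
    ((hev γ hγ (d * C * (2 * d * C ^ 2 + 1) / 2 + 2 * d * C) c₁ hc₁0).and
    ((hev (1 - γ) (by linarith) 2 (θ * c₁) (by positivity)).and
    ((hev 1 one_pos 1 1 one_pos).and self_mem_nhdsWithin))))).exists
  rw [Real.rpow_one, one_mul] at h5
  refine ⟨max 1 (4 / (θ * s₀)), le_max_left _ _, ?_⟩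
  intro ρ G M S β w hρ hG hS hSb hSh hβ hw hM heq
  have hρ1 : 1 ≤ ρ := (le_max_left _ _).trans hρ
  have hρ2 : 4 / (θ * s₀) ≤ ρ := (le_max_right _ _).trans hρ
  rw [div_le_iff₀ (by positivity)] at hρ2
  have hsup := mul_abs_le_of_solution hC0.le (by linarith)
    (fun x ξ => le_trans (by positivity) (hS x ξ)) hSb hβ hw hM heq
  refine ⟨hsup, fun x => ?_⟩
  have hM' : ∀ y, |w y| ≤ G / ρ := fun y => by
    rw [le_div_iff₀ (by linarith)]; linarith [hsup y]
  have hLG : 2 * G < θ * G * c₁ * s₀ ^ (γ - 1) := by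
    have e1 : s₀ ^ (γ - 1) = (s₀ ^ (1 - γ))⁻¹ := by
      rw [← Real.rpow_neg h6.le]; congr 1; ring
    rw [e1, ← div_eq_mul_inv, lt_div_iff₀ (by positivity)]
    nlinarith
  have hLM : 4 * (G / ρ) ≤ θ * G * s₀ := by
    rw [mul_div_assoc', div_le_iff₀ (by linarith)]
    nlinarith
  have hosc := sub_le_mul_norm_sub_of_solution hC (by linarith) hγ (by linarith)
    (L := θ * G) (by positivity) h6 h5.le (by linarith) h2.le h3.le hLG hLM hS hSb
    (by rw [hγα]; exact hSh) hβ hw hM' heq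
  refine ((hw.differentiable (by norm_num)) x).hasFDerivAt.le_of_lip' (by positivity) ?_
  filter_upwards [Metric.closedBall_mem_nhds x h6] with y hy
  rw [mem_closedBall, dist_eq_norm] at hy
  rw [Real.norm_eq_abs, abs_le]
  have h7 := hosc y x hy
  have h8 := hosc x y (by rwa [norm_sub_rev])
  rw [norm_sub_rev] at h8
  exact ⟨by linarith, h7⟩

end Gradient

section Gibbs

variable {Ω : Type*} [MeasurableSpace Ω] {μ : Measure Ω} [IsProbabilityMeasure μ]

lemma integral_exp_pos_of_bounded {h : Ω → ℝ} {K : ℝ} (hh : Measurable h)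
    (hK : ∀ᵐ u ∂μ, |h u| ≤ K) :
    Integrable (fun u => Real.exp (h u)) μ ∧ 0 < ∫ u, Real.exp (h u) ∂μ := by
  have hint : Integrable (fun u => Real.exp (h u)) μ := by
    refine Integrable.of_bound hh.exp.aestronglyMeasurable (Real.exp K) ?_
    filter_upwards [hK] with u hu
    rw [Real.norm_eq_abs, Real.abs_exp]
    exact Real.exp_le_exp.mpr ((le_abs_self _).trans hu)
  exact ⟨hint, integral_exp_pos hint⟩

/-- The log-partition function is `1`-Lipschitz with respect to the sup norm. -/
lemma mul_log_integral_exp_sub_le {lam K D : ℝ} (hlam : 0 < lam) {h₁ h₂ : Ω → ℝ}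
    (hm₁ : Measurable h₁) (hm₂ : Measurable h₂) (hb₁ : ∀ᵐ u ∂μ, |h₁ u| ≤ K)
    (hb₂ : ∀ᵐ u ∂μ, |h₂ u| ≤ K) (h12 : ∀ᵐ u ∂μ, h₁ u ≤ h₂ u + D) :
    lam * Real.log (∫ u, Real.exp ((1 / lam) * h₁ u) ∂μ) -
      lam * Real.log (∫ u, Real.exp ((1 / lam) * h₂ u) ∂μ) ≤ D := by
  have hbd : ∀ h : Ω → ℝ, (∀ᵐ u ∂μ, |h u| ≤ K) →
      ∀ᵐ u ∂μ, |(1 / lam) * h u| ≤ (1 / lam) * K := by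
    intro h hb
    filter_upwards [hb] with u hu
    rw [abs_mul, abs_of_pos (by positivity)]
    gcongr
  obtain ⟨hi₁, hp₁⟩ := integral_exp_pos_of_bounded (hm₁.const_mul (1 / lam)) (hbd h₁ hb₁)
  obtain ⟨hi₂, hp₂⟩ := integral_exp_pos_of_bounded (hm₂.const_mul (1 / lam)) (hbd h₂ hb₂)
  have hle : ∫ u, Real.exp ((1 / lam) * h₁ u) ∂μ ≤
      Real.exp ((1 / lam) * D) * ∫ u, Real.exp ((1 / lam) * h₂ u) ∂μ := by
    rw [← integral_const_mul]
    refine integral_mono_ae hi₁ (hi₂.const_mul _) ?_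
    filter_upwards [h12] with u hu
    rw [← Real.exp_add, Real.exp_le_exp, ← mul_add]
    gcongr
    linarith
  have hlog := Real.log_le_log hp₁ hle
  rw [Real.log_mul (Real.exp_pos _).ne' hp₂.ne', Real.log_exp] at hlog
  have := mul_le_mul_of_nonneg_left hlog hlam.le
  rw [mul_add, ← mul_assoc, mul_one_div_cancel hlam.ne', one_mul] at this
  linarith

/-- Entropy-regularized running reward of a Gibbs density, and the bound on its mean drift. -/
lemma gibbs_value {d : ℕ} {lam C : ℝ} (hlam : 0 < lam) (hC : 0 ≤ C) {r : Ω → ℝ}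
    {b : Ω → Fin d → ℝ} (hr : Measurable r) (hb : ∀ i, Measurable fun u => b u i)
    (hrC : ∀ᵐ u ∂μ, |r u| ≤ C) (hbC : ∀ᵐ u ∂μ, ∀ i, |b u i| ≤ C) (q p : Fin d → ℝ)
    {κ : Ω → ℝ} (hκ : κ = fun u => Real.exp ((1 / lam) * (r u + ∑ i, b u i * q i)) /
      ∫ u', Real.exp ((1 / lam) * (r u' + ∑ i, b u' i * q i)) ∂μ) :
    (∫ u, r u * κ u ∂μ) + ∑ i, (∫ u, b u i * κ u ∂μ) * p i -
        lam * ∫ u, Real.log (κ u) * κ u ∂μ =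
      lam * Real.log (∫ u, Real.exp ((1 / lam) * (r u + ∑ i, b u i * q i)) ∂μ) +
        ∑ i, (∫ u, b u i * κ u ∂μ) * (p i - q i) ∧
    ∀ i, |∫ u, b u i * κ u ∂μ| ≤ C := by
  set Q := ∑ i, |q i| with hQ
  have hhm : Measurable fun u => (1 / lam) * (r u + ∑ i, b u i * q i) :=
    (hr.add (Finset.measurable_sum _ fun i _ => (hb i).mul_const _)).const_mul _
  have hhb : ∀ᵐ u ∂μ, |(1 / lam) * (r u + ∑ i, b u i * q i)| ≤ (1 / lam) * (C + C * Q) := by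
    filter_upwards [hrC, hbC] with u h1 h2
    rw [abs_mul, abs_of_pos (by positivity : 0 < 1 / lam)]
    gcongr
    refine (abs_add_le _ _).trans (add_le_add h1 ?_)
    rw [hQ, Finset.mul_sum]
    refine (Finset.abs_sum_le_sum_abs _ _).trans (Finset.sum_le_sum fun i _ => ?_)
    rw [abs_mul]
    gcongr
    exact h2 i
  obtain ⟨hei, hZ⟩ := integral_exp_pos_of_bounded hhm hhb
  set Z := ∫ u, Real.exp ((1 / lam) * (r u + ∑ i, b u i * q i)) ∂μ with hZdef
  have hκi : Integrable κ μ := by rw [hκ]; exact hei.div_const _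
  have hκ0 : ∀ u, 0 < κ u := fun u => by rw [hκ]; positivity
  have hκ1 : ∫ u, κ u ∂μ = 1 := by
    rw [hκ, integral_div, div_self hZ.ne']
  have hri : Integrable (fun u => r u * κ u) μ :=
    hκi.bdd_mul hr.aestronglyMeasurable (c := C) (by simpa using hrC)
  have hbi : ∀ i, Integrable (fun u => b u i * κ u) μ := fun i =>
    hκi.bdd_mul (hb i).aestronglyMeasurable (c := C) (by
      filter_upwards [hbC] with u hu using by simpa using hu i)
  have hlog : ∀ u, Real.log (κ u) * κ u =
      (1 / lam) * (r u * κ u + ∑ i, b u i * κ u * q i) - Real.log Z * κ u := by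
    intro u
    have h1 : Real.log (κ u) = (1 / lam) * (r u + ∑ i, b u i * q i) - Real.log Z := by
      rw [hκ]
      simp only
      rw [Real.log_div (Real.exp_pos _).ne' hZ.ne', Real.log_exp]
    have h2 : ∑ i, b u i * κ u * q i = (∑ i, b u i * q i) * κ u := by
      rw [Finset.sum_mul]
      exact Finset.sum_congr rfl fun i _ => by ring
    rw [h1, h2]; ring
  have hent : ∫ u, Real.log (κ u) * κ u ∂μ =
      (1 / lam) * ((∫ u, r u * κ u ∂μ) + ∑ i, (∫ u, b u i * κ u ∂μ) * q i) - Real.log Z := by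
    simp only [hlog]
    have hsum : Integrable (fun u => ∑ i, b u i * κ u * q i) μ :=
      integrable_finsetSum _ fun i _ => (hbi i).mul_const _
    have hint : Integrable
        (fun u => (1 / lam) * (r u * κ u + ∑ i, b u i * κ u * q i)) μ :=
      (hri.add hsum).const_mul _
    rw [integral_sub hint (hκi.const_mul _), integral_const_mul, integral_const_mul, hκ1, mul_one,
      integral_add hri hsum, integral_finsetSum _ fun i _ => (hbi i).mul_const _]
    simp only [integral_mul_const]
  refine ⟨?_, fun i => ?_⟩
  · rw [hent]
    simp only [mul_sub, Finset.sum_sub_distrib]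
    rw [← mul_assoc, mul_one_div_cancel hlam.ne', one_mul]
    ring
  · calc |∫ u, b u i * κ u ∂μ| ≤ ∫ u, C * κ u ∂μ := by
          rw [← Real.norm_eq_abs]
          refine norm_integral_le_of_norm_le (hκi.const_mul C) ?_
          filter_upwards [hbC] with u hu
          rw [Real.norm_eq_abs, abs_mul, abs_of_pos (hκ0 u)]
          exact mul_le_mul_of_nonneg_right (hu i) (hκ0 u).le
      _ = C := by rw [integral_const_mul, hκ1, mul_one]

/-- One step of policy iteration: the residual of the difference with the exact solution is
controlled by the previous gradient error `q - s`. -/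
lemma abs_policy_residual_le {d : ℕ} {lam C P : ℝ} (hlam : 0 < lam) (hC : 0 ≤ C)
    {r : Ω → ℝ} {b : Ω → Fin d → ℝ} (hr : Measurable r) (hb : ∀ i, Measurable fun u => b u i)
    (hrC : ∀ᵐ u ∂μ, |r u| ≤ C) (hbC : ∀ᵐ u ∂μ, ∀ i, |b u i| ≤ C) (q p s : Fin d → ℝ)
    (hP : ∀ i, |q i - s i| ≤ P) {κ : Ω → ℝ}
    (hκ : κ = fun u => Real.exp ((1 / lam) * (r u + ∑ i, b u i * q i)) /
      ∫ u', Real.exp ((1 / lam) * (r u' + ∑ i, b u' i * q i)) ∂μ) {V V' T T' : ℝ}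
    (hV : V - (∫ u, r u * κ u ∂μ) - (∑ i, (∫ u, b u i * κ u ∂μ) * p i) - T +
      lam * (∫ u, Real.log (κ u) * κ u ∂μ) = 0)
    (hV' : V' - lam * Real.log (∫ u, Real.exp ((1 / lam) * (r u + ∑ i, b u i * s i)) ∂μ) -
      T' = 0) :
    |(V - V') - ∑ i, (∫ u, b u i * κ u ∂μ) * (p i - s i) - (T - T')| ≤ 2 * d * C * P := by
  obtain ⟨hval, hβ⟩ := gibbs_value hlam hC hr hb hrC hbC q p hκ
  have hmeas : ∀ z : Fin d → ℝ, Measurable fun u => r u + ∑ i, b u i * z i := fun z =>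
    hr.add (Finset.measurable_sum _ fun i _ => (hb i).mul_const _)
  have hbd : ∀ z : Fin d → ℝ, (∀ i, |z i| ≤ (∑ j, |q j|) + ∑ j, |s j|) →
      ∀ᵐ u ∂μ, |r u + ∑ i, b u i * z i| ≤ C + d * (C * ((∑ j, |q j|) + ∑ j, |s j|)) := by
    intro z hz
    filter_upwards [hrC, hbC] with u h1 h2
    exact (abs_add_le _ _).trans (add_le_add h1 (abs_sum_mul_le h2 hz))
  have hq := hbd q fun i => (Finset.single_le_sum (f := fun j => |q j|)
    (fun j _ => abs_nonneg _) (Finset.mem_univ i)).trans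
      (le_add_of_nonneg_right (Finset.sum_nonneg fun j _ => abs_nonneg _))
  have hs := hbd s fun i => (Finset.single_le_sum (f := fun j => |s j|)
    (fun j _ => abs_nonneg _) (Finset.mem_univ i)).trans
      (le_add_of_nonneg_left (Finset.sum_nonneg fun j _ => abs_nonneg _))
  have hdiff : ∀ᵐ u ∂μ, |∑ i, b u i * q i - ∑ i, b u i * s i| ≤ d * (C * P) := by
    filter_upwards [hbC] with u hu
    have := abs_sum_mul_le hu hP
    simpa only [mul_sub, Finset.sum_sub_distrib] using this
  have hqs := mul_log_integral_exp_sub_le hlam (hmeas q) (hmeas s) hq hs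
    (D := d * (C * P)) (by
      filter_upwards [hdiff] with u hu
      linarith [(abs_le.mp hu).2])
  have hsq := mul_log_integral_exp_sub_le hlam (hmeas s) (hmeas q) hs hq
    (D := d * (C * P)) (by
      filter_upwards [hdiff] with u hu
      linarith [(abs_le.mp hu).1])
  have hdrift := abs_le.mp (abs_sum_mul_le hβ hP)
  have hsplit : ∑ i, (∫ u, b u i * κ u ∂μ) * (p i - q i) =
      ∑ i, (∫ u, b u i * κ u ∂μ) * (p i - s i) -
        ∑ i, (∫ u, b u i * κ u ∂μ) * (q i - s i) := by
    rw [← Finset.sum_sub_distrib]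
    exact Finset.sum_congr rfl fun i _ => by ring
  rw [hsplit] at hval
  rw [abs_le]
  constructor <;> linarith [hdrift.1, hdrift.2]

end Gibbs

section PolicyIteration

variable {d : ℕ}

lemma pd1_sub {v w : EuclideanSpace ℝ (Fin d) → ℝ} (hv : ContDiff ℝ 2 v) (hw : ContDiff ℝ 2 w)
    (x : EuclideanSpace ℝ (Fin d)) (i : Fin d) :
    pd1 d (v - w) x i = pd1 d v x i - pd1 d w x i := by
  rw [pd1, pd1, pd1, fderiv_sub (hv.differentiable two_ne_zero x)
    (hw.differentiable two_ne_zero x)]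
  simp

lemma pd2_sub {v w : EuclideanSpace ℝ (Fin d) → ℝ} (hv : ContDiff ℝ 2 v) (hw : ContDiff ℝ 2 w)
    (x : EuclideanSpace ℝ (Fin d)) (i j : Fin d) :
    pd2 d (v - w) x i j = pd2 d v x i j - pd2 d w x i j := by
  have h : fderiv ℝ (v - w) = fderiv ℝ v - fderiv ℝ w := by
    ext1 y
    exact fderiv_sub (hv.differentiable two_ne_zero y) (hw.differentiable two_ne_zero y)
  have hvw : ContDiff ℝ 2 (v - w) := hv.sub hw
  rw [pd2_eq_fderiv_fderiv hvw, pd2_eq_fderiv_fderiv hv, pd2_eq_fderiv_fderiv hw, h,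
    fderiv_sub ((hv.fderiv_right (m := 1) le_rfl).differentiable one_ne_zero x)
      ((hw.fderiv_right (m := 1) le_rfl).differentiable one_ne_zero x)]
  simp

lemma abs_pd1_sub_le (v w : EuclideanSpace ℝ (Fin d) → ℝ) (x : EuclideanSpace ℝ (Fin d))
    (i : Fin d) : |pd1 d v x i - pd1 d w x i| ≤ ‖fderiv ℝ v x - fderiv ℝ w x‖ := by
  have := (fderiv ℝ v x - fderiv ℝ w x).le_opNorm (EuclideanSpace.single i 1)
  simpa [pd1] using this

lemma setIntegral_unit_ball_le {f : EuclideanSpace ℝ (Fin d) → ℝ} {c : ℝ}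
    (hf : ∀ x, |f x| ≤ c) (x₀ : EuclideanSpace ℝ (Fin d)) :
    ∫ x in ball x₀ 1, f x ≤ c * volume.real (ball (0 : EuclideanSpace ℝ (Fin d)) 1) := by
  have hvol : volume.real (ball x₀ 1) =
      volume.real (ball (0 : EuclideanSpace ℝ (Fin d)) 1) := by
    rw [Measure.real, Measure.real, Measure.addHaar_ball_center]
  rw [← hvol]
  exact (Real.le_norm_self _).trans
    (norm_setIntegral_le_of_norm_le_const measure_ball_lt_top fun x _ => hf x)

lemma mul_le_mul_rpow {B C t e : ℝ} (hB : 1 ≤ B) (hC : B ^ (d + 2) ≤ C) (ht : 0 < t)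
    (ht1 : t ≤ 1) (he : 1 / ((d : ℝ) + 2) ≤ e) (he1 : e ≤ 1) : B * t ≤ (C * t) ^ e := by
  have hB0 : 0 < B := by linarith
  have hpow : 1 ≤ B ^ (d + 2) := one_le_pow₀ hB
  have he0 : 0 ≤ e := le_trans (by positivity) he
  have hCB : B ≤ C ^ e := by
    calc B = B ^ (1 : ℝ) := (Real.rpow_one B).symm
      _ ≤ B ^ (((d + 2 : ℕ) : ℝ) * e) := by
          refine Real.rpow_le_rpow_of_exponent_le hB ?_
          rw [div_le_iff₀ (by positivity)] at he
          push_cast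
          linarith
      _ = (B ^ (d + 2)) ^ e := by rw [Real.rpow_mul hB0.le, Real.rpow_natCast]
      _ ≤ C ^ e := Real.rpow_le_rpow (by positivity) hC he0
  have htt : t ≤ t ^ e := by
    simpa using Real.rpow_le_rpow_of_exponent_ge ht ht1 he1
  rw [Real.mul_rpow (by linarith) ht.le]
  exact mul_le_mul hCB htt ht.le (hB0.le.trans hCB)

lemma div_le_rpow_neg_one_div {K ρ : ℝ} (hK : 1 ≤ K) (hρ : K ^ 2 ≤ ρ) :
    K / ρ ≤ ρ ^ (-(1 : ℝ) / ((d : ℝ) + 2)) := by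
  have hρ1 : 1 ≤ ρ := (one_le_pow₀ hK).trans hρ
  have hρ0 : 0 < ρ := by linarith
  have hle : (1 : ℝ) / ((d : ℝ) + 2) ≤ 1 / 2 := by
    gcongr
    linarith [(Nat.cast_nonneg d : (0 : ℝ) ≤ d)]
  rw [div_le_iff₀ hρ0]
  calc K = (K ^ 2) ^ ((1 : ℝ) / 2) := by
        rw [← Real.sqrt_eq_rpow, Real.sqrt_sq (by linarith)]
    _ ≤ ρ ^ ((1 : ℝ) / 2) := Real.rpow_le_rpow (by positivity) hρ (by norm_num)
    _ ≤ ρ ^ (-(1 : ℝ) / ((d : ℝ) + 2) + 1) := by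
        refine Real.rpow_le_rpow_of_exponent_le hρ1 ?_
        rw [neg_div]
        linarith
    _ = ρ ^ (-(1 : ℝ) / ((d : ℝ) + 2)) * ρ := by rw [Real.rpow_add hρ0, Real.rpow_one]

/-- The three convergence rates follow from geometric decay of the gradient error together with
decay of the discounted error. -/
lemma rates_of_geometric_decay {v w : EuclideanSpace ℝ (Fin d) → ℝ} {B C K ρ : ℝ} (hB : 1 ≤ B)
    (hC : B ^ (d + 2) + 2 * volume.real (ball (0 : EuclideanSpace ℝ (Fin d)) 1) * B ^ 2 ≤ C)
    (hK : 1 ≤ K) (hρ : K ^ 2 ≤ ρ) (n : ℕ)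
    (hval : ∀ x, ρ * |v x - w x| ≤ K * (B * (1 / 2) ^ n))
    (hgrad : ∀ x, ‖fderiv ℝ v x - fderiv ℝ w x‖ ≤ B * (1 / 2) ^ n) :
    (∀ x₀ : EuclideanSpace ℝ (Fin d),
      ρ * (∫ x in Metric.ball x₀ 1, (v x - w x) ^ 2) +
        (∫ x in Metric.ball x₀ 1, ‖fderiv ℝ v x - fderiv ℝ w x‖ ^ 2) ≤
        C * (2 : ℝ) ^ (-(n : ℝ))) ∧
    (∀ x, ‖fderiv ℝ v x - fderiv ℝ w x‖ ≤
      (C * (2 : ℝ) ^ (-(n : ℝ))) ^ ((1 : ℝ) / ((d : ℝ) + 2))) ∧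
    (∀ x, |v x - w x| ≤ ρ ^ (-(1 : ℝ) / ((d : ℝ) + 2)) *
      (C * (2 : ℝ) ^ (-(n : ℝ))) ^
        ((1 : ℝ) / ((d : ℝ) + 2) + (d : ℝ) / ((d : ℝ) + 2) ^ 2)) := by
  have hpow : (2 : ℝ) ^ (-(n : ℝ)) = (1 / 2) ^ n := by
    rw [Real.rpow_neg zero_le_two, Real.rpow_natCast, one_div, inv_pow]
  rw [hpow]
  set t : ℝ := (1 / 2) ^ n with ht
  have ht0 : 0 < t := by positivity
  have ht1 : t ≤ 1 := pow_le_one₀ (by norm_num) (by norm_num)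
  have hd : (0 : ℝ) ≤ d := Nat.cast_nonneg d
  have hρ1 : 1 ≤ ρ := (one_le_pow₀ hK).trans hρ
  have hρ0 : 0 < ρ := by linarith
  set ω := volume.real (ball (0 : EuclideanSpace ℝ (Fin d)) 1) with hω
  have hω0 : 0 ≤ ω := measureReal_nonneg
  have hCB : B ^ (d + 2) ≤ C := le_trans (le_add_of_nonneg_right (by positivity)) hC
  have hCω : 2 * ω * B ^ 2 ≤ C := le_trans (le_add_of_nonneg_left (by positivity)) hC
  refine ⟨fun x₀ => ?_, fun x => (hgrad x).trans ?_, fun x => ?_⟩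
  · have h1 : ∫ x in ball x₀ 1, (v x - w x) ^ 2 ≤ (B * t) ^ 2 / ρ * ω := by
      refine setIntegral_unit_ball_le (fun x => ?_) x₀
      rw [abs_of_nonneg (sq_nonneg _), le_div_iff₀ hρ0]
      have h : (ρ * |v x - w x|) ^ 2 ≤ (K * (B * t)) ^ 2 :=
        pow_le_pow_left₀ (by positivity) (hval x) 2
      rw [mul_pow, mul_pow K, sq_abs] at h
      have h' : K ^ 2 * (B * t) ^ 2 ≤ ρ * (B * t) ^ 2 :=
        mul_le_mul_of_nonneg_right hρ (sq_nonneg _)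
      refine le_of_mul_le_mul_left ?_ hρ0
      linarith
    have h2 : ∫ x in ball x₀ 1, ‖fderiv ℝ v x - fderiv ℝ w x‖ ^ 2 ≤ (B * t) ^ 2 * ω := by
      refine setIntegral_unit_ball_le (fun x => ?_) x₀
      rw [abs_of_nonneg (sq_nonneg _)]
      exact pow_le_pow_left₀ (norm_nonneg _) (hgrad x) 2
    have h3 : ρ * ((B * t) ^ 2 / ρ * ω) = (B * t) ^ 2 * ω := by field_simp
    have h4 : t ^ 2 ≤ t := by nlinarith
    calc _ ≤ ρ * ((B * t) ^ 2 / ρ * ω) + (B * t) ^ 2 * ω := by gcongr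
      _ = 2 * ω * B ^ 2 * t ^ 2 := by rw [h3]; ring
      _ ≤ C * t := by gcongr; exact le_trans (by positivity) hCω
  · exact mul_le_mul_rpow hB hCB ht0 ht1 le_rfl (by rw [div_le_one] <;> linarith)
  · have he1 : (1 : ℝ) / ((d : ℝ) + 2) + (d : ℝ) / ((d : ℝ) + 2) ^ 2 ≤ 1 := by
      rw [div_add_div _ _ (by positivity) (by positivity), div_le_one (by positivity)]
      nlinarith [sq_nonneg (d : ℝ), mul_nonneg hd (sq_nonneg (d : ℝ))]
    have h1 := mul_le_mul_rpow (d := d) (e := (1 : ℝ) / ((d : ℝ) + 2) +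
      (d : ℝ) / ((d : ℝ) + 2) ^ 2) hB hCB ht0 ht1 (le_add_of_nonneg_right (by positivity)) he1
    calc |v x - w x| ≤ K / ρ * (B * t) := by
          rw [div_mul_eq_mul_div, le_div_iff₀ hρ0, mul_comm]
          exact hval x
      _ ≤ _ := mul_le_mul (div_le_rpow_neg_one_div hK hρ) h1 (by positivity) (by positivity)

end PolicyIteration

/-- Exponential convergence of policy iteration when the diffusion is uncontrolled
(`Σ(x,u) = Σ₀(x)`, so `ε₀ = ε₁ = 0`): local `L²` and global sup-norm rates `C·2^{-n}`. -/
theorem stmt9 (d l : ℕ) (B : ℝ) (hB : 1 ≤ B) :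
    ∃ C : ℝ, 0 < C ∧
    ∀ (α lam C₀ : ℝ), 0 < α → α < 1 → 0 < lam → 1 ≤ C₀ →
    ∃ A₁ : ℝ, 1 ≤ A₁ ∧
    ∀ (U : Set (EuclideanSpace ℝ (Fin l)))
      (r : EuclideanSpace ℝ (Fin d) → EuclideanSpace ℝ (Fin l) → ℝ)
      (b : EuclideanSpace ℝ (Fin d) → EuclideanSpace ℝ (Fin l) → Fin d → ℝ)
      (S0 : EuclideanSpace ℝ (Fin d) → Matrix (Fin d) (Fin d) ℝ)
      (ρ : ℝ)
      (vstar : EuclideanSpace ℝ (Fin d) → ℝ)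
      (v : ℕ → EuclideanSpace ℝ (Fin d) → ℝ),
      MeasurableSet U → Bornology.IsBounded U → volume U = 1 →
      -- measurability in the control variable
      (∀ x, Measurable fun u => r x u) →
      (∀ x i, Measurable fun u => b x u i) →
      -- (cond1) with the u-independent diffusion Σ₀
      (∀ x (ξ : Fin d → ℝ),
        (1 / C₀) * ∑ i, ξ i ^ 2 ≤ ∑ i, ∑ j, ξ i * S0 x i j * ξ j) →
      (∀ u ∈ U, ∀ x, |r x u| ≤ C₀) →
      (∀ u ∈ U, ∀ x y, dist x y ≤ 1 → |r x u - r y u| ≤ C₀ * dist x y ^ α) →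
      (∀ u ∈ U, ∀ x i, |b x u i| ≤ C₀) →
      (∀ u ∈ U, ∀ x y, dist x y ≤ 1 → ∀ i, |b x u i - b y u i| ≤ C₀ * dist x y ^ α) →
      (∀ x i j, |S0 x i j| ≤ C₀) →
      (∀ x y, dist x y ≤ 1 → ∀ i j, |S0 x i j - S0 y i j| ≤ C₀ * dist x y ^ α) →
      -- Σ₀ is Lipschitz continuous
      (∃ K, ∀ x y i j, |S0 x i j - S0 y i j| ≤ K * dist x y) →
      -- v* is a bounded C^{2,α} classical solution of the exploratory HJB equation
      ContDiff ℝ 2 vstar →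
      (∃ K, ∀ x y, dist x y ≤ 1 →
        ‖iteratedFDeriv ℝ 2 vstar x - iteratedFDeriv ℝ 2 vstar y‖ ≤ K * dist x y ^ α) →
      (∀ x, ρ * vstar x
        - lam * Real.log (∫ u in U,
            Real.exp ((1 / lam) * (r x u + ∑ i, b x u i * pd1 d vstar x i)))
        - (1/2) * (∑ i, ∑ j, S0 x i j * pd2 d vstar x j i) = 0) →
      -- v⁰ ∈ C^{2,α}(ℝ^d)
      ContDiff ℝ 2 (v 0) →
      (∃ K, ∀ x y, dist x y ≤ 1 →
        ‖iteratedFDeriv ℝ 2 (v 0) x - iteratedFDeriv ℝ 2 (v 0) y‖ ≤ K * dist x y ^ α) →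
      -- ‖v⁰‖₂ + ‖v*‖₂ ≤ B
      (∀ x, (|v 0 x| + ‖fderiv ℝ (v 0) x‖ + ‖iteratedFDeriv ℝ 2 (v 0) x‖) +
        (|vstar x| + ‖fderiv ℝ vstar x‖ + ‖iteratedFDeriv ℝ 2 vstar x‖) ≤ B) →
      -- the iterates are bounded classical solutions of the linearized equations
      (∀ n : ℕ, 1 ≤ n → ContDiff ℝ 2 (v n) ∧ ∃ M, ∀ x, |v n x| ≤ M) →
      (∀ n : ℕ, 1 ≤ n → ∀ x,
        ρ * v n x
          - (∫ u in U, r x u * gibbsPolicy1 d l lam U r b (v (n - 1)) x u)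
          - (∑ i, (∫ u in U, b x u i * gibbsPolicy1 d l lam U r b (v (n - 1)) x u) *
              pd1 d (v n) x i)
          - (1/2) * (∑ i, ∑ j, S0 x i j * pd2 d (v n) x j i)
          + lam * (∫ u in U, Real.log (gibbsPolicy1 d l lam U r b (v (n - 1)) x u) *
              gibbsPolicy1 d l lam U r b (v (n - 1)) x u) = 0) →
      -- largeness of the discount rate
      A₁ ^ (2 / (1 - α)) ≤ ρ →
      -- conclusions: exponential convergence in n
      ∀ n : ℕ, 1 ≤ n →
        (∀ x₀ : EuclideanSpace ℝ (Fin d),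
          ρ * (∫ x in Metric.ball x₀ 1, (v n x - vstar x) ^ 2) +
            (∫ x in Metric.ball x₀ 1, ‖fderiv ℝ (v n) x - fderiv ℝ vstar x‖ ^ 2) ≤
            C * (2 : ℝ) ^ (-(n : ℝ))) ∧
        (∀ x, ‖fderiv ℝ (v n) x - fderiv ℝ vstar x‖ ≤
          (C * (2 : ℝ) ^ (-(n : ℝ))) ^ ((1 : ℝ) / ((d : ℝ) + 2))) ∧
        (∀ x, |v n x - vstar x| ≤
          ρ ^ (-(1 : ℝ) / ((d : ℝ) + 2)) *
            (C * (2 : ℝ) ^ (-(n : ℝ))) ^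
              ((1 : ℝ) / ((d : ℝ) + 2) + (d : ℝ) / ((d : ℝ) + 2) ^ 2)) := by
  set ω := volume.real (ball (0 : EuclideanSpace ℝ (Fin d)) 1) with hω
  have hω0 : 0 ≤ ω := measureReal_nonneg
  have hB0 : 0 < B := by linarith
  refine ⟨B ^ (d + 2) + 2 * ω * B ^ 2, by positivity, ?_⟩
  intro α lam C₀ hα hα1 hlam hC₀
  have hC₀0 : 0 ≤ C₀ := by linarith
  set K : ℝ := 2 * (2 * d * C₀ + 1) with hK
  have hdC : 0 ≤ 2 * (d : ℝ) * C₀ := by positivity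
  have hK2 : 2 ≤ K := by rw [hK]; linarith
  have hK0 : 0 < K := by linarith
  obtain ⟨ρ₀, hρ₀1, hest⟩ :=
    exists_discount_gradient_le d hα hα1 hC₀ (one_div_pos.mpr hK0)
  have hA1 : 1 ≤ ρ₀ + K ^ 2 := le_trans hρ₀1 (le_add_of_nonneg_right (sq_nonneg K))
  refine ⟨ρ₀ + K ^ 2, hA1, ?_⟩
  intro U r b S0 ρ vstar v hU _ hvol hrm hbm hell hr _ hb _ hS hSα _ hvs _ hjb hv0 _ hbd hvn hpde hρ
  have hAρ : ρ₀ + K ^ 2 ≤ ρ := by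
    refine le_trans ?_ hρ
    have h1 : (1 : ℝ) ≤ 2 / (1 - α) := by
      rw [le_div_iff₀ (by linarith)]
      linarith
    simpa using Real.rpow_le_rpow_of_exponent_le hA1 h1
  have hρ₀ : ρ₀ ≤ ρ := by linarith [sq_nonneg K]
  have hKρ : K ^ 2 ≤ ρ := by linarith
  have hprob : IsProbabilityMeasure (volume.restrict U) :=
    ⟨by rw [Measure.restrict_apply_univ, hvol]⟩
  have hsmooth : ∀ n, ContDiff ℝ 2 (v n) := by
    intro n
    rcases Nat.eq_zero_or_pos n with rfl | hn
    · exact hv0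
    · exact (hvn n hn).1
  have hstep : ∀ n (P : ℝ), 0 < P → (∀ x, ‖fderiv ℝ (v n) x - fderiv ℝ vstar x‖ ≤ P) →
      (∀ x, ρ * |v (n + 1) x - vstar x| ≤ K / 2 * P) ∧
        ∀ x, ‖fderiv ℝ (v (n + 1)) x - fderiv ℝ vstar x‖ ≤ P / 2 := by
    intro n P hP hprev
    obtain ⟨M, hM⟩ := (hvn (n + 1) n.succ_pos).2
    have hstar : ∀ x, |vstar x| ≤ B := fun x => by
      linarith [hbd x, abs_nonneg (v 0 x), norm_nonneg (fderiv ℝ (v 0) x),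
        norm_nonneg (iteratedFDeriv ℝ 2 (v 0) x), norm_nonneg (fderiv ℝ vstar x),
        norm_nonneg (iteratedFDeriv ℝ 2 vstar x)]
    have hrU : ∀ x, ∀ᵐ u ∂(volume.restrict U), |r x u| ≤ C₀ := fun x =>
      ae_restrict_of_forall_mem hU fun u hu => hr u hu x
    have hbU : ∀ x, ∀ᵐ u ∂(volume.restrict U), ∀ i, |b x u i| ≤ C₀ := fun x =>
      ae_restrict_of_forall_mem hU fun u hu => hb u hu x
    obtain ⟨hval, hgrad⟩ := hest ρ (K / 2 * P) (M + B) S0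
      (fun x i => ∫ u in U, b x u i * gibbsPolicy1 d l lam U r b (v n) x u)
      (v (n + 1) - vstar) hρ₀ (by positivity) hell hS hSα
      (fun x => (gibbs_value hlam hC₀0 (hrm x) (hbm x) (hrU x) (hbU x) (pd1 d (v n) x)
        (pd1 d (v n) x) rfl).2)
      ((hsmooth (n + 1)).sub hvs)
      (fun x => (abs_sub _ _).trans (add_le_add (hM x) (hstar x)))
      (fun x => by
        have hres := abs_policy_residual_le hlam hC₀0 (hrm x) (hbm x) (hrU x) (hbU x)
          (pd1 d (v n) x) (pd1 d (v (n + 1)) x) (pd1 d vstar x)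
          (fun i => (abs_pd1_sub_le _ _ x i).trans (hprev x))
          (κ := gibbsPolicy1 d l lam U r b (v n) x) rfl
          (hpde (n + 1) n.succ_pos x) (hjb x)
        have hbound : 2 * (d : ℝ) * C₀ * P ≤ K / 2 * P := by
          gcongr
          rw [hK]
          linarith
        refine le_trans (le_of_eq ?_) (hres.trans hbound)
        simp only [pd1_sub (hsmooth (n + 1)) hvs, pd2_sub (hsmooth (n + 1)) hvs, Pi.sub_apply,
          mul_sub, Finset.sum_sub_distrib])
    refine ⟨hval, fun x => ?_⟩
    have h := hgrad x
    rw [fderiv_sub ((hsmooth (n + 1)).differentiable two_ne_zero x)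
      (hvs.differentiable two_ne_zero x)] at h
    refine h.trans (le_of_eq ?_)
    field_simp
  have hdecay : ∀ n x, ‖fderiv ℝ (v n) x - fderiv ℝ vstar x‖ ≤ B * (1 / 2) ^ n := by
    intro n
    induction n with
    | zero =>
      intro x
      rw [pow_zero, mul_one]
      refine (norm_sub_le _ _).trans ?_
      linarith [hbd x, abs_nonneg (v 0 x), abs_nonneg (vstar x),
        norm_nonneg (iteratedFDeriv ℝ 2 (v 0) x), norm_nonneg (iteratedFDeriv ℝ 2 vstar x)]
    | succ n ih =>
      intro x
      refine ((hstep n _ (by positivity) ih).2 x).trans (le_of_eq ?_)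
      ring
  intro n hn
  obtain ⟨m, rfl⟩ := Nat.exists_eq_add_of_le' hn
  refine rates_of_geometric_decay hB le_rfl (by linarith) hKρ (m + 1) (fun x => ?_)
    (hdecay (m + 1))
  refine ((hstep m _ (by positivity) (hdecay m)).1 x).trans (le_of_eq ?_)
  ring
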